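/- arXiv:1308.2364 — 2 statements merged into one kernel-verified Lean document; each statement's English description precedes it below -/
import Mathlib

section
/- Let G be a finite noncyclic group of order n and let p be the smallest prime divisor of n. Then the small Davenport constant satisfies d(G) ≤ n/p + 9p² − 10p. -/
/-- The set `Π(S)` of all products of nonempty subsequences of the sequence
(multiset) `S` over `G`, where the terms of a subsequence may be taken in any order. -/
def subseqProds {G : Type*} [Group G] (S : Multiset G) : Set G :=
  {x | ∃ l : List G, l ≠ [] ∧ (l : Multiset G) ≤ S ∧ l.prod = x}

/-- A sequence `S` over `G` is one-product free if no nonempty subsequence of it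
can be ordered so that the product of its terms is `1`. -/
def OneProdFree {G : Type*} [Group G] (S : Multiset G) : Prop :=
  (1 : G) ∉ subseqProds S

/-- The small Davenport constant: the maximal length of a one-product free
sequence over `G`. -/
noncomputable def smallDavenport (G : Type*) [Group G] [Fintype G] : ℕ :=
  sSup {n | ∃ S : Multiset G, OneProdFree S ∧ Multiset.card S = n}

namespace SmallDavenport

open scoped Pointwise Classical
open Finset
variable {G : Type*} [Group G]

theorem card_add_card_le_card_mul_add_one [Fintype G] (A B : Finset G) (hA : 1 ∈ A) (hB : 1 ∈ B)
    (h : ∀ a ∈ A, ∀ b ∈ B, a * b = 1 → a = 1) : #A + #B ≤ #(A * B) + 1 := by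
  have key : ∀ k : ℕ, ∀ A B : Finset G, 1 ∈ A → 1 ∈ B →
      (∀ a ∈ A, ∀ b ∈ B, a * b = 1 → a = 1) →
      (2 * Fintype.card G - (#A + #B)) * (Fintype.card G + 1) + (Fintype.card G - #A) = k →
      #A + #B ≤ #(A * B) + 1 := by
    intro k
    induction k using Nat.strong_induction_on with
    | _ k ih =>
    intro A B hA hB h hk
    by_cases hAB : A ∩ B ⊆ {1}
    · have h1 : A ∪ B ⊆ A * B := union_subset
        (fun a ha => by simpa using mul_mem_mul ha hB) (fun b hb => by simpa using mul_mem_mul hA hb)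
      have h2 := card_le_card h1
      have h3 := card_le_card hAB
      have h4 := card_union_add_card_inter A B
      simp at h3
      omega
    · obtain ⟨e, he, he1⟩ := not_subset.1 hAB
      have he1 : e ≠ 1 := by simpa using he1
      obtain ⟨heA, heB⟩ := mem_inter.1 he
      set A' := (mulETransformRight e (A, B)).1 with hA'
      set B' := (mulETransformRight e (A, B)).2 with hB'
      set A'' := (mulETransformLeft e⁻¹ (A, B)).1 with hA''
      set B'' := (mulETransformLeft e⁻¹ (A, B)).2 with hB''
      have mA' : ∀ x, x ∈ A' ↔ x ∈ A ∨ x * e⁻¹ ∈ A := by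
        intro x; simp [hA', mem_smul_finset]
        refine or_congr_right ⟨?_, fun h => ⟨_, h, by simp⟩⟩
        rintro ⟨y, hy, rfl⟩; simpa
      have mB' : ∀ x, x ∈ B' ↔ x ∈ B ∧ e * x ∈ B := by
        intro x; simp [hB', mem_smul_finset]
        refine fun _ => ⟨?_, fun h => ⟨_, h, by simp⟩⟩
        rintro ⟨y, hy, rfl⟩; simpa
      have mA'' : ∀ x, x ∈ A'' ↔ x ∈ A ∧ x * e ∈ A := by
        intro x; simp [hA'', mem_smul_finset]
        refine fun _ => ⟨?_, fun h => ⟨_, h, by simp⟩⟩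
        rintro ⟨y, hy, rfl⟩; simpa
      have mB'' : ∀ x, x ∈ B'' ↔ x ∈ B ∨ e⁻¹ * x ∈ B := by
        intro x; simp [hB'', mem_smul_finset]
        refine or_congr_right ⟨?_, fun h => ⟨_, h, by simp⟩⟩
        rintro ⟨y, hy, rfl⟩; simpa
      have eA : e⁻¹ ∉ A := fun hc => he1 (by simpa using h _ hc e heB (by simp))
      have eB : e⁻¹ ∉ B := fun hc => he1 (by simpa using h e heA _ hc (by simp))
      have sub' : A' * B' ⊆ A * B := mulETransformRight.fst_mul_snd_subset e (A, B)
      have sub'' : A'' * B'' ⊆ A * B := mulETransformLeft.fst_mul_snd_subset e⁻¹ (A, B)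
      have c1 : #A' + #A'' = 2 * #A := by
        have h1 : #(mulETransformLeft e (A, B)).1 + #A' = 2 * #A :=
          mulETransformLeft.card e (A, B)
        have : #A'' = #(mulETransformLeft e (A, B)).1 := by
          rw [← card_smul_finset (MulOpposite.op e) A'']
          congr 1
          simp [hA'', smul_finset_inter, inter_comm]
        omega
      have c2 : #B' + #B'' = 2 * #B := by
        have h1 : #(mulETransformLeft e (A, B)).2 + #B' = 2 * #B :=
          mulETransformRight.card e (A, B)
        have : #B'' = #(mulETransformLeft e (A, B)).2 := by
          rw [← card_smul_finset e⁻¹ B'']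
          congr 1
          simp [hB'', smul_finset_union, union_comm]
        omega
      have u' : ∀ a ∈ A', ∀ b ∈ B', a * b = 1 → a = 1 := by
        intro a ha b hb hab
        rw [mB'] at hb
        rcases (mA' a).1 ha with ha | ha
        · exact h a ha b hb.1 hab
        · have := h _ ha _ hb.2 (by simp [mul_assoc, hab])
          have hae : a = e := mul_inv_eq_one.1 this
          exact absurd hb.1 (by rw [← inv_eq_of_mul_eq_one_right hab, hae]; exact eB)
      have u'' : ∀ a ∈ A'', ∀ b ∈ B'', a * b = 1 → a = 1 := by
        intro a ha b hb hab
        rw [mA''] at ha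
        rcases (mB'' b).1 hb with hb | hb
        · exact h a ha.1 b hb hab
        · have := h _ ha.2 _ hb (by simp [mul_assoc, hab])
          exact absurd ha.1 (by rw [eq_inv_of_mul_eq_one_left this]; exact eA)
      have o1 : 1 ∈ A' := (mA' 1).2 (Or.inl hA)
      have o2 : 1 ∈ B' := (mB' 1).2 ⟨hB, by simpa⟩
      have o3 : 1 ∈ A'' := (mA'' 1).2 ⟨hA, by simpa⟩
      have o4 : 1 ∈ B'' := (mB'' 1).2 (Or.inl hB)
      have b1 := card_le_univ A'
      have b2 := card_le_univ B'
      have b3 := card_le_univ A''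
      have b4 := card_le_univ B''
      by_cases hc : #A + #B ≤ #A' + #B'
      · have hlt : #A < #A' := by
          apply card_lt_card
          rw [ssubset_iff_of_subset (fun x hx => (mA' x).2 (Or.inl hx))]
          by_contra! hcon
          have hs : MulOpposite.op e • A ⊆ A := fun x hx => by
            apply hcon; rw [mA']; right
            obtain ⟨y, hy, rfl⟩ := mem_smul_finset.1 hx
            simpa
          have heq := eq_of_subset_of_card_le hs (by rw [card_smul_finset])
          apply eA
          rw [← heq] at hA
          obtain ⟨y, hy, hy1⟩ := mem_smul_finset.1 hA
          simp at hy1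
          rwa [← eq_inv_of_mul_eq_one_left hy1]
        have := ih _ ?_ A' B' o1 o2 u' rfl
        · have := card_le_card sub'; omega
        · rw [← hk]
          have : (2 * Fintype.card G - (#A' + #B')) * (Fintype.card G + 1) ≤
            (2 * Fintype.card G - (#A + #B)) * (Fintype.card G + 1) :=
            Nat.mul_le_mul_right _ (by omega)
          omega
      · have := ih _ ?_ A'' B'' o3 o4 u'' rfl
        · have := card_le_card sub''; omega
        · rw [← hk]
          have : (2 * Fintype.card G - (#A'' + #B'') + 1) * (Fintype.card G + 1) ≤
            (2 * Fintype.card G - (#A + #B)) * (Fintype.card G + 1) :=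
            Nat.mul_le_mul_right _ (by omega)
          rw [add_mul] at this
          omega
  exact key _ A B hA hB h rfl

theorem oneProdFree_iff {S : Multiset G} :
    OneProdFree S ↔ ∀ l : List G, (l : Multiset G) ≤ S → l.prod = 1 → l = [] := by
  simp only [OneProdFree, subseqProds, Set.mem_ofPred_eq, not_exists, not_and]
  exact ⟨fun h l h1 h2 => by_contra fun h3 => h l h3 h1 h2,
    fun h l h1 h2 h3 => h1 (h l h2 h3)⟩

theorem _root_.OneProdFree.mono {S T : Multiset G} (hT : OneProdFree T) (h : S ≤ T) : OneProdFree S := by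
  rw [oneProdFree_iff] at *
  exact fun l h1 h2 => hT l (h1.trans h) h2

theorem _root_.OneProdFree.ne_one {S : Multiset G} (hS : OneProdFree S) {g : G} (hg : g ∈ S) : g ≠ 1 := by
  rintro rfl
  have := (oneProdFree_iff.1 hS) [1] (by simpa using hg) (by simp)
  simp at this

variable [Fintype G]

/-- The products of all (possibly empty) subsequences of `S`, in any order. -/
noncomputable def prodSet (S : Multiset G) : Finset G :=
  univ.filter fun x => ∃ l : List G, (l : Multiset G) ≤ S ∧ l.prod = x

theorem mem_prodSet {S : Multiset G} {x : G} :
    x ∈ prodSet S ↔ ∃ l : List G, (l : Multiset G) ≤ S ∧ l.prod = x := by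
  simp [prodSet]

theorem prod_mem_prodSet {S : Multiset G} {l : List G} (h : (l : Multiset G) ≤ S) :
    l.prod ∈ prodSet S := mem_prodSet.2 ⟨l, h, rfl⟩

theorem one_mem_prodSet (S : Multiset G) : 1 ∈ prodSet S :=
  mem_prodSet.2 ⟨[], by simp, by simp⟩

theorem prodSet_mono {S T : Multiset G} (h : S ≤ T) : prodSet S ⊆ prodSet T := by
  intro x hx
  obtain ⟨l, hl, rfl⟩ := mem_prodSet.1 hx
  exact prod_mem_prodSet (hl.trans h)

theorem mul_mem_prodSet_add {S T : Multiset G} {x y : G} (hx : x ∈ prodSet S)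
    (hy : y ∈ prodSet T) : x * y ∈ prodSet (S + T) := by
  obtain ⟨l, hl, rfl⟩ := mem_prodSet.1 hx
  obtain ⟨l', hl', rfl⟩ := mem_prodSet.1 hy
  rw [← List.prod_append]
  exact prod_mem_prodSet (by rw [← Multiset.coe_add]; exact add_le_add hl hl')

theorem mem_prodSet_of_mem {S : Multiset G} {g : G} (hg : g ∈ S) : g ∈ prodSet S :=
  mem_prodSet.2 ⟨[g], by simpa using hg, by simp⟩

theorem prodSet_mul_subset (S T : Multiset G) : prodSet S * prodSet T ⊆ prodSet (S + T) := by
  intro x hx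
  obtain ⟨a, ha, b, hb, rfl⟩ := mem_mul.1 hx
  exact mul_mem_prodSet_add ha hb

theorem eq_one_of_mem_prodSet {S T : Multiset G} (h : OneProdFree (S + T)) {x y : G}
    (hx : x ∈ prodSet S) (hy : y ∈ prodSet T) (hxy : x * y = 1) : x = 1 := by
  obtain ⟨l, hl, rfl⟩ := mem_prodSet.1 hx
  obtain ⟨l', hl', rfl⟩ := mem_prodSet.1 hy
  rw [← List.prod_append] at hxy
  have := oneProdFree_iff.1 h (l ++ l') (by rw [← Multiset.coe_add]; exact add_le_add hl hl') hxy
  simp at this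
  simp [this.1]

theorem card_prodSet_add {S T : Multiset G} (h : OneProdFree (S + T)) :
    #(prodSet S) + #(prodSet T) ≤ #(prodSet (S + T)) + 1 :=
  (card_add_card_le_card_mul_add_one _ _ (one_mem_prodSet S) (one_mem_prodSet T)
    fun _ ha _ hb hab => eq_one_of_mem_prodSet h ha hb hab).trans
    (Nat.add_le_add_right (card_le_card (prodSet_mul_subset S T)) 1)

theorem card_prodSet_cons {S : Multiset G} {g : G} (h : OneProdFree (g ::ₘ S)) :
    #(prodSet S) + 1 ≤ #(prodSet (g ::ₘ S)) := by
  have h1 : OneProdFree ({g} + S) := by simpa using h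
  have h2 := card_prodSet_add h1
  have h3 : 2 ≤ #(prodSet ({g} : Multiset G)) := by
    rw [← card_pair (h.ne_one (Multiset.mem_cons_self g S))]
    apply card_le_card
    intro x hx
    rcases mem_insert.1 hx with rfl | hx
    · exact mem_prodSet_of_mem (by simp)
    · rw [mem_singleton.1 hx]; exact one_mem_prodSet _
  rw [Multiset.singleton_add] at h2
  omega

theorem card_lt_card_prodSet {S : Multiset G} (h : OneProdFree S) :
    Multiset.card S + 1 ≤ #(prodSet S) := by
  induction S using Multiset.induction with
  | empty => simpa using ⟨1, one_mem_prodSet _⟩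
  | cons g S ih =>
    have := ih (h.mono (Multiset.le_cons_self S g))
    have := card_prodSet_cons h
    simp; omega

theorem card_prodSet_le_of_subgroup {S : Multiset G} (K : Subgroup G) (h : ∀ g ∈ S, g ∈ K) :
    #(prodSet S) ≤ Nat.card K := by
  have h1 : Nat.card K = #(K : Set G).toFinset := Nat.card_eq_card_toFinset (K : Set G)
  rw [h1]
  apply card_le_card
  intro x hx
  obtain ⟨l, hl, rfl⟩ := mem_prodSet.1 hx
  simp only [Set.mem_toFinset, SetLike.mem_coe]
  exact K.list_prod_mem fun g hg => h g (Multiset.mem_of_le hl (by simpa using hg))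

/-- The cosets of `K` met by the finite set `X`. -/
noncomputable def cosets (K : Subgroup G) (X : Finset G) : Finset (G ⧸ K) :=
  X.image (QuotientGroup.mk : G → G ⧸ K)

theorem le_of_dvd_of_ne_one {n p : ℕ} (hmin : ∀ q : ℕ, q.Prime → q ∣ n → p ≤ q) {d : ℕ} (hd : d ∣ n)
    (h1 : d ≠ 1) (hn : n ≠ 0) : p ≤ d := by
  refine (hmin _ (Nat.minFac_prime h1) ((Nat.minFac_dvd d).trans hd)).trans ?_
  exact Nat.minFac_le (Nat.pos_of_dvd_of_pos hd (Nat.pos_of_ne_zero hn))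

theorem card_subgroup_le {p : ℕ}
    (hmin : ∀ q : ℕ, q.Prime → q ∣ Fintype.card G → p ≤ q) {K : Subgroup G} (hK : K ≠ ⊤) :
    Nat.card K * p ≤ Fintype.card G := by
  have h1 := K.card_mul_index
  rw [Nat.card_eq_fintype_card (α := G)] at h1
  have h2 : p ≤ K.index := le_of_dvd_of_ne_one hmin (Dvd.intro_left _ h1)
    (by simpa using hK) Fintype.card_ne_zero
  calc _ ≤ _ := Nat.mul_le_mul_left _ h2
    _ = _ := h1

theorem le_card_of_smul_subset {p : ℕ}
    (hmin : ∀ q : ℕ, q.Prime → q ∣ Fintype.card G → p ≤ q) {K : Subgroup G}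
    (C : Finset (G ⧸ K)) (h1 : ((1 : G) : G ⧸ K) ∈ C) {t : G} (ht : t ∉ K)
    (hC : ∀ c ∈ C, t • c ∈ C) : p ≤ #C := by
  have horb : (MulAction.orbit (Subgroup.zpowers t) ((1 : G) : G ⧸ K)) ⊆ C := by
    rintro _ ⟨⟨s, hs⟩, rfl⟩
    have hs' : s ∈ Submonoid.powers t := mem_powers_iff_mem_zpowers.2 hs
    obtain ⟨k, rfl⟩ := hs'
    change t ^ k • ((1 : G) : G ⧸ K) ∈ C
    clear hs
    induction k with
    | zero => simpa using h1
    | succ k ih =>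
      rw [pow_succ', mul_smul]
      exact hC _ (by simpa using ih)
  have hdvd : Nat.card (MulAction.orbit (Subgroup.zpowers t) ((1 : G) : G ⧸ K)) ∣
      Fintype.card G := by
    have h2 := MulAction.card_orbit_mul_card_stabilizer_eq_card_group (Subgroup.zpowers t)
      ((1 : G) : G ⧸ K)
    rw [← Nat.card_eq_fintype_card, ← Nat.card_eq_fintype_card, ← Nat.card_eq_fintype_card] at h2
    refine (Dvd.intro _ h2).trans ?_
    rw [← Nat.card_eq_fintype_card]
    exact Subgroup.card_subgroup_dvd_card _
  have hne : Nat.card (MulAction.orbit (Subgroup.zpowers t) ((1 : G) : G ⧸ K)) ≠ 1 := by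
    intro hc
    rw [Nat.card_eq_one_iff_unique] at hc
    have hs := hc.1
    have := @Subsingleton.elim _ hs ⟨_, MulAction.mem_orbit_self _⟩
      ⟨_, MulAction.mem_orbit ((1 : G) : G ⧸ K) (⟨t, Subgroup.mem_zpowers t⟩ : Subgroup.zpowers t)⟩
    have this : ((1 : G) : G ⧸ K) = ((t * 1 : G) : G ⧸ K) := congrArg Subtype.val this
    rw [QuotientGroup.eq] at this
    exact ht (by simpa using this)
  have h3 := le_of_dvd_of_ne_one hmin hdvd hne Fintype.card_ne_zero
  refine h3.trans ?_
  have h4 := Set.ncard_le_ncard horb (Finset.finite_toSet _)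
  rwa [Set.ncard_coe_finset] at h4

theorem min_le_card_cosets {p : ℕ}
    (hmin : ∀ q : ℕ, q.Prime → q ∣ Fintype.card G → p ≤ q) {K : Subgroup G} {T : Multiset G}
    (hT : ∀ t ∈ T, t ∉ K) : min p (Multiset.card T + 1) ≤ #(cosets K (prodSet T)) := by
  induction T using Multiset.induction with
  | empty =>
    have : 0 < #(cosets K (prodSet (0 : Multiset G))) :=
      card_pos.2 ⟨_, mem_image_of_mem _ (one_mem_prodSet _)⟩
    rw [Multiset.card_zero]; omega
  | cons t T ih =>
    rw [Multiset.card_cons]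
    have ih := ih fun s hs => hT s (Multiset.mem_cons_of_mem hs)
    have ht := hT t (Multiset.mem_cons_self t T)
    have hsub : cosets K (prodSet T) ⊆ cosets K (prodSet (t ::ₘ T)) :=
      image_subset_image (prodSet_mono (Multiset.le_cons_self T t))
    by_cases hC : ∀ c ∈ cosets K (prodSet T), t • c ∈ cosets K (prodSet T)
    · have : p ≤ #(cosets K (prodSet T)) :=
        le_card_of_smul_subset hmin _ (mem_image_of_mem _ (one_mem_prodSet _)) ht hC
      have := card_le_card hsub
      omega
    · push Not at hC
      obtain ⟨c, hc, hc'⟩ := hC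
      have : #(insert (t • c) (cosets K (prodSet T))) ≤ #(cosets K (prodSet (t ::ₘ T))) := by
        apply card_le_card
        apply insert_subset _ hsub
        obtain ⟨x, hx, rfl⟩ := mem_image.1 hc
        refine mem_image.2 ⟨t * x, ?_, rfl⟩
        rw [← Multiset.singleton_add]
        exact mul_mem_prodSet_add (mem_prodSet_of_mem (by simp)) hx
      rw [card_insert_of_notMem hc'] at this
      omega

theorem mul_card_le_card_prodSet_add {K : Subgroup G} (T R : Multiset G)
    (hR : ∀ g ∈ R, g ∈ K) :
    #(cosets K (prodSet T)) * #(prodSet R) ≤ #(prodSet (T + R)) := by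
  have hf : ∀ c : G ⧸ K, ∃ x : G, c ∈ cosets K (prodSet T) →
      x ∈ prodSet T ∧ (x : G ⧸ K) = c := by
    intro c
    by_cases hc : c ∈ cosets K (prodSet T)
    · obtain ⟨x, hx, rfl⟩ := mem_image.1 hc
      exact ⟨x, fun _ => ⟨hx, rfl⟩⟩
    · exact ⟨1, fun h => absurd h hc⟩
  choose f hf using hf
  have hK : ∀ x ∈ prodSet R, x ∈ K := by
    intro x hx
    obtain ⟨l, hl, rfl⟩ := mem_prodSet.1 hx
    exact K.list_prod_mem fun g hg => hR g (Multiset.mem_of_le hl (by simpa using hg))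
  rw [← card_product]
  refine card_le_card_of_injOn (fun q => f q.1 * q.2) ?_ ?_
  · rintro ⟨c, x⟩ hq
    obtain ⟨hc, hx⟩ := mem_product.1 hq
    exact mul_mem_prodSet_add (hf c hc).1 hx
  · rintro ⟨c, x⟩ hq ⟨c', x'⟩ hq' h
    obtain ⟨hc, hx⟩ := mem_product.1 hq
    obtain ⟨hc', hx'⟩ := mem_product.1 hq'
    have hcc : c = c' := by
      rw [← (hf c hc).2, ← (hf c' hc').2, ← QuotientGroup.mk_mul_of_mem _ (hK x hx),
        ← QuotientGroup.mk_mul_of_mem (f c') (hK x' hx')]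
      exact congrArg _ h
    subst hcc
    simpa using h

end SmallDavenport

namespace SmallDavenport

open scoped Pointwise Classical
open Finset
variable {G : Type*} [Group G] [Fintype G]

theorem card_add_card_mul_right_notMem_le (W : Multiset G) (b : G) :
    #(prodSet W) + #{x ∈ prodSet W | x * b ∉ prodSet W} ≤ #(prodSet (b ::ₘ W)) := by
  have h1 : prodSet W ∪ ({x ∈ prodSet W | x * b ∉ prodSet W}).image (· * b) ⊆
      prodSet (b ::ₘ W) := by
    refine union_subset (prodSet_mono (Multiset.le_cons_self W b)) fun y hy => ?_
    obtain ⟨x, hx, rfl⟩ := mem_image.1 hy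
    rw [← Multiset.singleton_add, add_comm]
    exact mul_mem_prodSet_add (mem_filter.1 hx).1 (mem_prodSet_of_mem (by simp))
  refine le_trans (le_of_eq ?_) (card_le_card h1)
  rw [card_union_of_disjoint, card_image_of_injective _ (mul_left_injective b)]
  rw [disjoint_right]
  intro y hy
  obtain ⟨x, hx, rfl⟩ := mem_image.1 hy
  exact (mem_filter.1 hx).2

theorem card_add_card_mul_left_notMem_le (W : Multiset G) (b : G) :
    #(prodSet W) + #{x ∈ prodSet W | b * x ∉ prodSet W} ≤ #(prodSet (b ::ₘ W)) := by
  have h1 : prodSet W ∪ ({x ∈ prodSet W | b * x ∉ prodSet W}).image (b * ·) ⊆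
      prodSet (b ::ₘ W) := by
    refine union_subset (prodSet_mono (Multiset.le_cons_self W b)) fun y hy => ?_
    obtain ⟨x, hx, rfl⟩ := mem_image.1 hy
    rw [← Multiset.singleton_add]
    exact mul_mem_prodSet_add (mem_prodSet_of_mem (by simp)) (mem_filter.1 hx).1
  refine le_trans (le_of_eq ?_) (card_le_card h1)
  rw [card_union_of_disjoint, card_image_of_injective _ (mul_right_injective b)]
  rw [disjoint_right]
  intro y hy
  obtain ⟨x, hx, rfl⟩ := mem_image.1 hy
  exact (mem_filter.1 hx).2

/-- The number of elements of `X` in a given left coset. -/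
noncomputable def cosetCount (K : Subgroup G) (X : Finset G) (c : G ⧸ K) : ℕ :=
  #{x ∈ X | (QuotientGroup.mk x : G ⧸ K) = c}

theorem card_fiber_mk (K : Subgroup G) (c : G ⧸ K) :
    #{x : G | (QuotientGroup.mk x : G ⧸ K) = c} = Nat.card K := by
  obtain ⟨y, rfl⟩ := QuotientGroup.mk_surjective c
  have h1 : Nat.card K = #(K : Set G).toFinset := Nat.card_eq_card_toFinset (K : Set G)
  rw [h1, ← card_image_of_injective (K : Set G).toFinset (mul_right_injective y)]
  congr 1
  ext x
  rw [mem_filter, mem_image]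
  simp only [mem_univ, true_and, Set.mem_toFinset, SetLike.mem_coe]
  rw [eq_comm (a := (QuotientGroup.mk x : G ⧸ K)), QuotientGroup.eq]
  exact ⟨fun h => ⟨_, h, by simp⟩, by rintro ⟨z, hz, rfl⟩; simpa using hz⟩

theorem cosetCount_le (K : Subgroup G) (X : Finset G) (c : G ⧸ K) :
    cosetCount K X c ≤ Nat.card K := by
  rw [← card_fiber_mk K c]
  exact card_le_card (filter_subset_filter _ (subset_univ _))

theorem cosetCount_lt {K : Subgroup G} {X : Finset G} {z : G} (hz : z ∉ X) :
    cosetCount K X (z : G ⧸ K) < Nat.card K := by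
  rw [← card_fiber_mk K (z : G ⧸ K)]
  apply card_lt_card
  rw [ssubset_iff_of_subset (filter_subset_filter _ (subset_univ _))]
  exact ⟨z, by simp, by simp [hz]⟩

omit [Fintype G] in
theorem cosetCount_pos {K : Subgroup G} {X : Finset G} {z : G} (hz : z ∈ X) :
    0 < cosetCount K X (z : G ⧸ K) :=
  card_pos.2 ⟨z, by simp [hz]⟩

omit [Fintype G] in
theorem cosetCount_le_smul (K : Subgroup G) (X : Finset G) (h : G) (c : G ⧸ K) :
    cosetCount K X c ≤ cosetCount K X (h • c) + #{x ∈ X | h * x ∉ X} := by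
  unfold cosetCount
  rw [← card_image_of_injective ({x ∈ X | (QuotientGroup.mk x : G ⧸ K) = c}) (mul_right_injective h),
    ← card_image_of_injective ({x ∈ X | h * x ∉ X}) (mul_right_injective h)]
  refine (card_le_card ?_).trans (card_union_le _ _)
  intro y hy
  obtain ⟨x, hx, rfl⟩ := mem_image.1 hy
  obtain ⟨hxX, rfl⟩ := mem_filter.1 hx
  rw [mem_union]
  by_cases hX : h * x ∈ X
  · left
    exact mem_filter.2 ⟨hX, rfl⟩
  · right
    exact mem_image_of_mem _ (mem_filter.2 ⟨hxX, hX⟩)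

theorem card_partial_cosets_le {g : G} {H : Subgroup G} (hH : H = Subgroup.zpowers g)
    (X : Finset G) :
    #{c : G ⧸ H | 0 < cosetCount _ X c ∧
      cosetCount _ X c < Nat.card H} ≤ #{x ∈ X | x * g ∉ X} := by
  refine (card_le_card ?_).trans (card_image_le (s := {x ∈ X | x * g ∉ X})
    (f := (QuotientGroup.mk : G → G ⧸ H)))
  intro c hc
  obtain ⟨-, h0, h1⟩ := mem_filter.1 hc
  by_contra hcon
  have hcl : ∀ x ∈ X, (QuotientGroup.mk x : G ⧸ H) = c → x * g ∈ X := by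
    intro x hx hxc
    by_contra hxg
    exact hcon (mem_image.2 ⟨x, mem_filter.2 ⟨hx, hxg⟩, hxc⟩)
  obtain ⟨x, hx⟩ := card_pos.1 h0
  obtain ⟨hx, hxc⟩ := mem_filter.1 hx
  refine h1.not_ge ?_
  rw [← card_fiber_mk _ c]
  apply card_le_card
  intro y hy
  have hyc := (mem_filter.1 hy).2
  refine mem_filter.2 ⟨?_, hyc⟩
  rw [← hxc, eq_comm, QuotientGroup.eq, hH, ← mem_powers_iff_mem_zpowers] at hyc
  obtain ⟨k, hk⟩ := hyc
  have hk' : y = x * g ^ k := by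
    have : g ^ k = x⁻¹ * y := hk
    rw [this]; simp
  rw [hk']
  clear hk hk' hy
  induction k with
  | zero => simpa
  | succ k ih =>
    rw [pow_succ, ← mul_assoc]
    refine hcl _ ih ?_
    rw [← hxc, QuotientGroup.mk_mul_of_mem _ (hH ▸ pow_mem (Subgroup.mem_zpowers g) k)]

theorem eq_empty_or_univ_of_forall_smul_mem {K : Subgroup G} {R : Multiset G}
    (hR : ∀ K : Subgroup G, K ≠ ⊤ → ∃ b ∈ R, b ∉ K) (L : Finset (G ⧸ K))
    (hL : ∀ b ∈ R, ∀ c ∈ L, b • c ∈ L) : L = ∅ ∨ L = univ := by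
  have htop : MulAction.stabilizer G L = ⊤ := by
    by_contra hne
    obtain ⟨b, hb, hbK⟩ := hR _ hne
    apply hbK
    rw [MulAction.mem_stabilizer_iff]
    refine eq_of_subset_of_card_le (fun y hy => ?_) (by rw [card_smul_finset])
    obtain ⟨c, hc, rfl⟩ := mem_smul_finset.1 hy
    exact hL b hb c hc
  rcases L.eq_empty_or_nonempty with h | ⟨c, hc⟩
  · exact Or.inl h
  · right
    refine eq_univ_of_forall fun d => ?_
    obtain ⟨h, rfl⟩ := MulAction.exists_smul_eq G c d
    have : h ∈ MulAction.stabilizer G L := by rw [htop]; trivial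
    rw [← MulAction.mem_stabilizer_iff.1 this]
    exact smul_mem_smul_finset hc

/-- The terms of `S` lying outside the subgroup `K`. -/
noncomputable def outside (K : Subgroup G) (S : Multiset G) : Multiset G := S.filter (· ∉ K)

omit [Fintype G] in
theorem mem_outside {K : Subgroup G} {S : Multiset G} {g : G} :
    g ∈ outside K S ↔ g ∈ S ∧ g ∉ K := Multiset.mem_filter

omit [Fintype G] in
theorem outside_le (K : Subgroup G) (S : Multiset G) : outside K S ≤ S := Multiset.filter_le _ _

omit [Fintype G] in
theorem outside_map_inv (K : Subgroup G) (S : Multiset G) :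
    outside K (S.map fun t => t⁻¹) = (outside K S).map fun t => t⁻¹ := by
  simp [outside, Multiset.filter_map]

omit [Fintype G] in
theorem outside_top (S : Multiset G) : outside ⊤ S = 0 := by
  simp [outside]

theorem le_card_cosets_of_le_card_outside {p : ℕ}
    (hmin : ∀ q : ℕ, q.Prime → q ∣ Fintype.card G → p ≤ q) {K : Subgroup G} {T : Multiset G}
    (hT : p - 1 ≤ Multiset.card (outside K T)) : p ≤ #(cosets K (prodSet T)) := by
  have h1 := min_le_card_cosets hmin (K := K) (T := outside K T)
    fun t ht => (mem_outside.1 ht).2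
  have h2 : #(cosets K (prodSet (outside K T))) ≤ #(cosets K (prodSet T)) :=
    card_le_card (image_subset_image (prodSet_mono (outside_le K T)))
  omega

theorem inv_mem_prodSet_of_map_inv {T : Multiset G} {z : G}
    (hz : z ∈ prodSet (T.map fun t => t⁻¹)) : z⁻¹ ∈ prodSet T := by
  obtain ⟨l, hl, rfl⟩ := mem_prodSet.1 hz
  rw [List.prod_inv_reverse]
  apply prod_mem_prodSet
  rw [Multiset.coe_reverse, ← Multiset.map_coe]
  have := Multiset.map_le_map (f := fun t : G => t⁻¹) hl
  simpa using this

theorem exists_growth_of_large_order {p : ℕ} (hp : 2 ≤ p)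
    (hmin : ∀ q : ℕ, q.Prime → q ∣ Fintype.card G → p ≤ q) {W R : Multiset G}
    (hWR : OneProdFree (W + R))
    (hW : ∀ g : G, p - 1 ≤ Multiset.card (outside (Subgroup.zpowers g) W))
    (hR : ∀ K : Subgroup G, K ≠ ⊤ → p - 1 ≤ Multiset.card (outside K R))
    {g : G} (hg : g ∈ R) (hm : p * (p - 1) < orderOf g) :
    ∃ b ∈ R, p ≤ #{x ∈ prodSet W | x * b ∉ prodSet W} ∨
      p ≤ #{x ∈ prodSet W | b * x ∉ prodSet W} := by
  by_contra! hcon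
  set X := prodSet W with hX
  obtain ⟨H, hH⟩ : ∃ H, H = Subgroup.zpowers g := ⟨_, rfl⟩
  have hcard : Nat.card H = orderOf g := by rw [hH, Nat.card_zpowers]
  set P : Finset (G ⧸ H) := {c | 0 < cosetCount H X c ∧ cosetCount H X c < Nat.card H} with hP
  have hPcard : #P ≤ p - 1 := by
    have : #P ≤ _ := card_partial_cosets_le hH X
    have := (hcon g hg).1
    omega
  have hWH : p ≤ #(cosets H X) := le_card_cosets_of_le_card_outside hmin (hH ▸ hW g)
  have hHtop : H ≠ ⊤ := by
    intro htop
    have := hW g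
    rw [← hH, htop, outside_top, Multiset.card_zero] at this
    omega
  let L : ℕ → Finset (G ⧸ H) := fun θ => {c | θ < cosetCount H X c}
  have hLm : ∀ θ c, c ∈ L θ ↔ θ < cosetCount H X c := fun θ c => by simp [L]
  have hLanti : ∀ a b, a ≤ b → L b ⊆ L a := fun a b hab c hc => by
    rw [hLm] at *; omega
  have key : ∃ θ < orderOf g, ∀ h ∈ R, ∀ c ∈ L θ, h • c ∈ L θ := by
    by_contra! hno
    have hmap : ∀ θ ∈ range (orderOf g), #(L θ) ∈
        Finset.Ico #{c : G ⧸ H | cosetCount H X c = Nat.card H}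
          (#{c : G ⧸ H | cosetCount H X c = Nat.card H} + p) := by
      intro θ hθ
      have hθ := mem_range.1 hθ
      rw [mem_Ico]
      constructor
      · apply card_le_card
        intro c hc
        rw [hLm, (mem_filter.1 hc).2]; omega
      · have : L θ ⊆ ({c | cosetCount H X c = Nat.card H} : Finset (G ⧸ H)) ∪ P := by
          intro c hc
          rw [hLm] at hc
          have := cosetCount_le H X c
          rw [mem_union, mem_filter, hP, mem_filter]
          simp only [mem_univ, true_and]
          omega
        have := (card_le_card this).trans (card_union_le _ _)
        omega
    obtain ⟨y, -, hy⟩ := exists_lt_card_fiber_of_mul_lt_card_of_maps_to hmap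
      (n := p - 1) (by simpa using hm)
    set Θ : Finset ℕ := {θ ∈ range (orderOf g) | #(L θ) = y} with hΘ
    have hne : Θ.Nonempty := card_pos.1 (by omega)
    set a := Θ.min' hne
    set b := Θ.max' hne
    have hab : p ≤ b + 1 - a := by
      have h1 : Θ ⊆ Icc a b := fun θ hθ => mem_Icc.2 ⟨Θ.min'_le _ hθ, Θ.le_max' _ hθ⟩
      have h2 := card_le_card h1
      rw [Nat.card_Icc] at h2
      omega
    have ha := mem_filter.1 (Θ.min'_mem hne)
    have hb := mem_filter.1 (Θ.max'_mem hne)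
    have hLab : L b = L a := eq_of_subset_of_card_le (hLanti a b (by omega))
      (by rw [show #(L a) = y from ha.2, show #(L b) = y from hb.2])
    obtain ⟨h, hh, c, hc, hhc⟩ := hno a (mem_range.1 ha.1)
    have h1 := cosetCount_le_smul H X h c
    have h2 := (hcon h hh).2
    rw [hLm] at hhc
    rw [← hLab, hLm] at hc
    omega
  obtain ⟨θ, hθ, hinv⟩ := key
  have hR' : ∀ K : Subgroup G, K ≠ ⊤ → ∃ b ∈ R, b ∉ K := by
    intro K hK
    have h1 := hR K hK
    obtain ⟨b, hb⟩ := Multiset.card_pos_iff_exists_mem.1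
      (show 0 < Multiset.card (outside K R) by omega)
    exact ⟨b, mem_outside.1 hb⟩
  rcases eq_empty_or_univ_of_forall_smul_mem hR' (L θ) hinv with h | h
  · have hsub : cosets H X ⊆ P := by
      intro c hc
      obtain ⟨x, hx, rfl⟩ := mem_image.1 hc
      rw [hP, mem_filter]
      refine ⟨mem_univ _, cosetCount_pos hx, ?_⟩
      have : (QuotientGroup.mk x : G ⧸ H) ∉ L θ := by rw [h]; simp
      rw [hLm] at this
      omega
    have := card_le_card hsub
    omega
  · have hfree : ∀ z, z ≠ 1 → z⁻¹ ∈ prodSet R → z ∉ X := by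
      intro z hz hzR hzX
      exact hz (eq_one_of_mem_prodSet hWR hzX hzR (by simp))
    have hRH : p - 1 ≤ Multiset.card (outside H (R.map fun t => t⁻¹)) := by
      rw [outside_map_inv, Multiset.card_map]
      exact hR H hHtop
    have hp2 : p ≤ #(cosets H (prodSet (R.map fun t => t⁻¹))) := le_card_cosets_of_le_card_outside hmin hRH
    have hsub : cosets H (prodSet (R.map fun t => t⁻¹)) ⊆ P := by
      intro c hc
      obtain ⟨z, hz, rfl⟩ := mem_image.1 hc
      have hz' := inv_mem_prodSet_of_map_inv hz
      rw [hP, mem_filter]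
      refine ⟨mem_univ _, ?_, ?_⟩
      · have : (QuotientGroup.mk z : G ⧸ H) ∈ L θ := by rw [h]; simp
        rw [hLm] at this
        omega
      · by_cases hz1 : z = 1
        · have hgR : OneProdFree R := hWR.mono (Multiset.le_add_left R W)
          have h1 : g⁻¹ ∉ X := hfree _ (by simpa using hgR.ne_one hg)
            (by simpa using mem_prodSet_of_mem hg)
          have h2 : (QuotientGroup.mk z : G ⧸ H) = QuotientGroup.mk g⁻¹ := by
            rw [hz1, QuotientGroup.eq]
            simp [hH]
          rw [h2]
          exact cosetCount_lt h1
        · exact cosetCount_lt (hfree z hz1 hz')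
    have := card_le_card hsub
    omega

end SmallDavenport

namespace SmallDavenport

open scoped Pointwise Classical
open Finset
variable {G : Type*} [Group G] [Fintype G]

theorem exists_sumset_three {m : ℕ} [Fact m.Prime] {u : ZMod m} (h0 : u ≠ 0) (h1 : u ≠ 1) (a : ℕ) :
    ∃ A : Finset (ZMod m), min m (2 * a + 1) ≤ #A ∧
      ∀ z ∈ A, ∃ x y : ℕ, x + y ≤ a ∧ z = x * u + y := by
  induction a with
  | zero => exact ⟨{0}, by simp, by simp⟩
  | succ a ih =>
    obtain ⟨A, hA, hA'⟩ := ih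
    have hne : A.Nonempty := card_pos.1 (by
      have := (Fact.out : m.Prime).pos; omega)
    refine ⟨A + {0, 1, u}, ?_, ?_⟩
    · have h3 : #({0, 1, u} : Finset (ZMod m)) = 3 :=
        card_eq_three.2 ⟨0, 1, u, zero_ne_one, h0.symm, h1.symm, rfl⟩
      have := ZMod.cauchy_davenport (Fact.out : m.Prime) hne
        (t := {0, 1, u}) ⟨0, by simp⟩
      rw [h3] at this
      omega
    · intro z hz
      obtain ⟨b, hb, c, hc, rfl⟩ := mem_add.1 hz
      obtain ⟨x, y, hxy, rfl⟩ := hA' b hb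
      simp only [mem_insert, mem_singleton] at hc
      rcases hc with rfl | rfl | rfl
      · exact ⟨x, y, by omega, by simp⟩
      · exact ⟨x, y + 1, by omega, by push_cast; ring⟩
      · exact ⟨x + 1, y, by omega, by push_cast; ring⟩

omit [Fintype G] in
theorem pow_val_injective {g : G} {m : ℕ} [NeZero m] (hm : orderOf g = m) :
    Function.Injective fun z : ZMod m => g ^ z.val := by
  intro z z' h
  have h1 := pow_injOn_Iio_orderOf (x := g) (by simpa [hm] using z.val_lt)
    (by simpa [hm] using z'.val_lt) h
  exact ZMod.val_injective m h1

theorem card_prodSet_of_conj_notMem {g h : G} {m : ℕ} (hgm : orderOf g = m) (hm : m.Prime) {N : ℕ}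
    (hN : N < m) (hh : h⁻¹ * g * h ∉ Subgroup.zpowers g) :
    (N + 1) * (N + 2) / 2 + 1 ≤ #(prodSet (h ::ₘ Multiset.replicate N g)) := by
  have hcard : ∀ N : ℕ, #((range (N + 1)).sigma fun k => antidiagonal k) = (N + 1) * (N + 2) / 2 := by
    intro N
    have : ∀ N : ℕ, (∑ k ∈ range (N + 1), (k + 1)) * 2 = (N + 1) * (N + 2) := by
      intro N
      induction N with
      | zero => simp
      | succ N ih => rw [sum_range_succ, add_mul, ih]; ring
    rw [card_sigma]
    simp only [Nat.card_antidiagonal]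
    rw [← this, Nat.mul_div_cancel _ two_pos]
  have hhH : h ∉ Subgroup.zpowers g := fun hc => hh
    (mul_mem (mul_mem (inv_mem hc) (Subgroup.mem_zpowers g)) hc)
  have hlt : ∀ {i i' j j' : ℕ}, i < i' → i' < m → g ^ i * h * g ^ j ≠ g ^ i' * h * g ^ j' := by
    intro i i' j j' hi hi' he
    obtain ⟨d, rfl⟩ := Nat.exists_eq_add_of_lt hi
    have h1 : h⁻¹ * g ^ (d + 1) * h = g ^ j * (g ^ j')⁻¹ := by
      rw [add_assoc, pow_add] at he
      simp only [mul_assoc, mul_right_inj] at he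
      rw [eq_mul_inv_iff_mul_eq, mul_assoc, mul_assoc, inv_mul_eq_iff_eq_mul, he]
    have hco : (d + 1).Coprime (orderOf g) := by
      rw [hgm, Nat.coprime_comm, hm.coprime_iff_not_dvd]
      intro hd
      have := Nat.le_of_dvd (by omega) hd
      omega
    obtain ⟨k, hk⟩ := exists_pow_eq_self_of_coprime hco
    apply hh
    have h2 : h⁻¹ * g * h = (h⁻¹ * g ^ (d + 1) * h) ^ k := by
      have := conj_pow (i := k) (a := h⁻¹) (b := g ^ (d + 1))
      rw [inv_inv, hk] at this
      exact this.symm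
    rw [h2, h1]
    exact pow_mem (mul_mem (pow_mem (Subgroup.mem_zpowers g) _)
      (inv_mem (pow_mem (Subgroup.mem_zpowers g) _))) _
  set s := (range (N + 1)).sigma fun k => antidiagonal k
  have hs : ∀ q ∈ s, q.2.1 + q.2.2 ≤ N := by
    rintro ⟨k, i, j⟩ hq
    have := mem_sigma.1 hq
    simp only [mem_range, HasAntidiagonal.mem_antidiagonal] at this
    simp only
    omega
  have hs' : ∀ q ∈ s, q.2.1 + q.2.2 = q.1 := by
    rintro ⟨k, i, j⟩ hq
    have := mem_sigma.1 hq
    simp only [mem_range, HasAntidiagonal.mem_antidiagonal] at this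
    simp only
    omega
  let f : (Σ _ : ℕ, ℕ × ℕ) → G := fun q => g ^ q.2.1 * h * g ^ q.2.2
  have hinj : Set.InjOn f s := by
    rintro ⟨k, i, j⟩ hq ⟨k', i', j'⟩ hq' he
    have h1 := hs' _ hq
    have h2 := hs' _ hq'
    have h3 := hs _ hq
    have h4 := hs _ hq'
    simp only at h1 h2 h3 h4
    have hii : i = i' := by
      rcases lt_trichotomy i i' with hlt' | he' | hlt'
      · exact absurd he (hlt hlt' (show i' < m by omega))
      · exact he'
      · exact absurd he.symm (hlt hlt' (show i < m by omega))
    subst hii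
    have he : g ^ j = g ^ j' := by simpa [f] using he
    have hjj := pow_injOn_Iio_orderOf (x := g) (by simp [hgm]; omega) (by simp [hgm]; omega) he
    subst hjj
    subst h1
    subst h2
    rfl
  have h1 : (1 : G) ∉ s.image f := by
    intro h1
    obtain ⟨⟨k, i, j⟩, -, hq⟩ := mem_image.1 h1
    apply hhH
    have : h = (g ^ i)⁻¹ * (g ^ j)⁻¹ := by
      have hq : g ^ i * h * g ^ j = 1 := hq
      rw [eq_inv_mul_iff_mul_eq, eq_inv_iff_mul_eq_one, hq]
    rw [this]
    exact mul_mem (inv_mem (pow_mem (Subgroup.mem_zpowers g) _))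
      (inv_mem (pow_mem (Subgroup.mem_zpowers g) _))
  rw [← hcard, ← card_image_of_injOn hinj, ← card_insert_of_notMem h1]
  apply card_le_card
  refine insert_subset (one_mem_prodSet _) fun y hy => ?_
  obtain ⟨⟨k, i, j⟩, hq, rfl⟩ := mem_image.1 hy
  have h3 := hs _ hq
  simp only at h3
  refine mem_prodSet.2 ⟨List.replicate i g ++ [h] ++ List.replicate j g, ?_, by simp [f, mul_assoc]⟩
  rw [← Multiset.coe_add, ← Multiset.coe_add, Multiset.coe_replicate, Multiset.coe_replicate,
    add_right_comm, ← Multiset.replicate_add, Multiset.coe_singleton, add_comm,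
    Multiset.singleton_add]
  exact Multiset.cons_le_cons _ (Multiset.replicate_le_replicate _ |>.2 h3)

theorem card_prodSet_of_conj_mem {p : ℕ} (hp : 2 ≤ p)
    (hmin : ∀ q : ℕ, q.Prime → q ∣ Fintype.card G → p ≤ q)
    {g : G} {m : ℕ} (hgm : orderOf g = m) (hm : m.Prime) (hpm : 2 * p - 1 ≤ m)
    {L : Multiset G} (hL : p - 1 ≤ Multiset.card L)
    (hconj : ∀ h ∈ L, h⁻¹ * g * h ∈ Subgroup.zpowers g) (hcomm : ∀ h ∈ L, h * g ≠ g * h) :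
    p * (2 * p - 2) + 1 ≤ #(prodSet (L + Multiset.replicate (p - 1) g)) := by
  have : Fact m.Prime := ⟨hm⟩
  obtain ⟨H, hH⟩ : ∃ H, H = Subgroup.zpowers g := ⟨_, rfl⟩
  have hLH : ∀ h ∈ L, h ∉ H := by
    intro h hh hc
    rw [hH] at hc
    obtain ⟨k, rfl⟩ := Subgroup.mem_zpowers_iff.1 hc
    exact hcomm _ hh (by rw [← zpow_add_one, ← zpow_one_add, add_comm])
  have hcos := min_le_card_cosets hmin hLH
  have hcos : p ≤ #(cosets H (prodSet L)) := by omega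
  set X := prodSet (L + Multiset.replicate (p - 1) g) with hX
  have hone : ((1 : G) : G ⧸ H) ∈ cosets H (prodSet L) := mem_image_of_mem _ (one_mem_prodSet L)
  have htriv : p ≤ cosetCount H X ((1 : G) : G ⧸ H) := by
    have : #((range p).image (g ^ ·)) = p := by
      rw [card_image_of_injOn, card_range]
      intro i hi j hj hij
      have hi' := mem_range.1 hi
      have hj' := mem_range.1 hj
      exact pow_injOn_Iio_orderOf (x := g) (by simp [hgm]; omega) (by simp [hgm]; omega) hij
    refine this.symm.le.trans (card_le_card fun y hy => ?_)
    obtain ⟨i, hi, rfl⟩ := mem_image.1 hy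
    have hi := mem_range.1 hi
    refine mem_filter.2 ⟨mem_prodSet.2 ⟨List.replicate i g, ?_, by simp⟩, ?_⟩
    · rw [Multiset.coe_replicate]
      exact (Multiset.replicate_le_replicate _ |>.2 (by omega)).trans (Multiset.le_add_left _ _)
    · rw [eq_comm, QuotientGroup.eq, hH]
      simp
  have hnontriv : ∀ c ∈ (cosets H (prodSet L)).erase ((1 : G) : G ⧸ H),
      2 * p - 1 ≤ cosetCount H X c := by
    intro c hc
    obtain ⟨hc1, hc⟩ := mem_erase.1 hc
    obtain ⟨w, hw, rfl⟩ := mem_image.1 hc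
    obtain ⟨l, hl, rfl⟩ := mem_prodSet.1 hw
    rcases List.eq_nil_or_concat l with rfl | ⟨l', h, rfl⟩
    · exact absurd (by simp) hc1
    · rw [List.concat_eq_append] at *
      have hhL : h ∈ L := Multiset.mem_of_le hl (by simp)
      obtain ⟨u, hu⟩ := mem_powers_iff_mem_zpowers.2 (hconj h hhL)
      have hu : g ^ u = h⁻¹ * g * h := hu
      have hu0 : (u : ZMod m) ≠ 0 := by
        rw [Ne, ZMod.natCast_eq_zero_iff]
        intro hd
        rw [← hgm] at hd
        rw [orderOf_dvd_iff_pow_eq_one.1 hd] at hu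
        have : g = 1 := by
          have := congrArg (fun x => h * x * h⁻¹) hu
          simpa [mul_assoc] using this.symm
        rw [this, orderOf_one] at hgm
        exact hm.ne_one hgm.symm
      have hu1 : (u : ZMod m) ≠ 1 := by
        intro h1
        have h1 : (u : ZMod m) = (1 : ℕ) := by simpa using h1
        rw [ZMod.natCast_eq_natCast_iff, ← hgm, ← pow_eq_pow_iff_modEq, pow_one] at h1
        apply hcomm h hhL
        rw [h1] at hu
        nth_rewrite 1 [hu]
        simp [mul_assoc]
      obtain ⟨A, hA, hA'⟩ := exists_sumset_three hu0 hu1 (p - 1)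
      have hinj : Function.Injective fun z : ZMod m => (l' ++ [h]).prod * g ^ z.val :=
        (mul_right_injective _).comp (pow_val_injective hgm)
      refine le_trans (by omega : _ ≤ #A) ?_
      rw [← card_image_of_injective A hinj]
      refine card_le_card fun y hy => ?_
      obtain ⟨z, hz, rfl⟩ := mem_image.1 hy
      obtain ⟨x, y, hxy, rfl⟩ := hA' z hz
      have hpow : g ^ ((x * u + y : ZMod m)).val = h⁻¹ * g ^ x * h * g ^ y := by
        have h1 : ((x * u + y : ZMod m)) = ((x * u + y : ℕ) : ZMod m) := by push_cast; ring
        rw [h1, ZMod.val_natCast, ← hgm, pow_mod_orderOf, pow_add, mul_comm x u, pow_mul, hu]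
        have := conj_pow (i := x) (a := h⁻¹) (b := g)
        rw [inv_inv] at this
        rw [this]
      refine mem_filter.2 ⟨?_, ?_⟩
      · rw [hpow, hX]
        refine mem_prodSet.2 ⟨l' ++ List.replicate x g ++ [h] ++ List.replicate y g, ?_, ?_⟩
        · have : ((l' ++ List.replicate x g ++ [h] ++ List.replicate y g : List G) : Multiset G) =
            ((l' ++ [h] : List G) : Multiset G) + Multiset.replicate (x + y) g := by
            simp only [← Multiset.coe_add, Multiset.replicate_add, Multiset.coe_replicate]
            ac_rfl
          rw [this]
          exact add_le_add hl (Multiset.replicate_le_replicate _ |>.2 hxy)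
        · simp [mul_assoc]
      · rw [QuotientGroup.mk_mul_of_mem]
        rw [hH]
        exact pow_mem (Subgroup.mem_zpowers g) _
  have hsum : ∑ c ∈ cosets H (prodSet L), cosetCount H X c ≤ #X := by
    unfold cosetCount
    rw [← card_biUnion]
    · exact card_le_card (biUnion_subset.2 fun c _ => filter_subset _ _)
    · intro c _ d _ hcd
      rw [Function.onFun, disjoint_left]
      intro x hx hx'
      exact hcd ((mem_filter.1 hx).2.symm.trans (mem_filter.1 hx').2)
  rw [← add_sum_erase _ _ hone] at hsum
  have h1 : _ ≤ ∑ c ∈ (cosets H (prodSet L)).erase ((1 : G) : G ⧸ H), cosetCount H X c :=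
    card_nsmul_le_sum _ _ _ hnontriv
  rw [card_erase_of_mem hone, smul_eq_mul] at h1
  have h2 : (p - 1) * (2 * p - 1) ≤ (#(cosets H (prodSet L)) - 1) * (2 * p - 1) :=
    Nat.mul_le_mul_right _ (by omega)
  obtain ⟨r, rfl⟩ := Nat.exists_eq_add_of_le hp
  have h3 : (2 + r) * (2 * (2 + r) - 2) + 1 = (2 + r - 1) * (2 * (2 + r) - 1) + (2 + r) := by
    rw [show 2 * (2 + r) - 2 = 2 + 2 * r by omega, show 2 + r - 1 = 1 + r by omega,
      show 2 * (2 + r) - 1 = 3 + 2 * r by omega]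
    ring
  omega

end SmallDavenport

namespace SmallDavenport

open scoped Pointwise Classical
open Finset
variable {G : Type*} [Group G]

/-- The number of elements of `A` that right multiplication by `y` moves out of `A`. -/
noncomputable def rightGrowth (A : Finset G) (y : G) : ℕ := #{x ∈ A | x * y ∉ A}

theorem rightGrowth_one (A : Finset G) : rightGrowth A 1 = 0 := by
  simp [rightGrowth]

theorem card_filter_add_rightGrowth (A : Finset G) (y : G) :
    #{x ∈ A | x * y ∈ A} + rightGrowth A y = #A :=
  card_filter_add_card_filter_not _

theorem rightGrowth_inv (A : Finset G) (y : G) : rightGrowth A y⁻¹ = rightGrowth A y := by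
  have h1 := card_filter_add_rightGrowth A y
  have h2 := card_filter_add_rightGrowth A y⁻¹
  have h3 : #{x ∈ A | x * y ∈ A} = #{x ∈ A | x * y⁻¹ ∈ A} := by
    refine card_bij (fun x _ => x * y) ?_ (fun _ _ _ _ h => mul_right_cancel h) ?_
    · intro x hx
      have hx := mem_filter.1 hx
      exact mem_filter.2 ⟨hx.2, by simpa using hx.1⟩
    · intro x hx
      have hx := mem_filter.1 hx
      exact ⟨x * y⁻¹, mem_filter.2 ⟨hx.2, by simpa using hx.1⟩, by simp⟩
  omega

theorem rightGrowth_mul_le (A : Finset G) (y z : G) :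
    rightGrowth A (y * z) ≤ rightGrowth A y + rightGrowth A z := by
  unfold rightGrowth
  rw [← card_image_of_injective ({x ∈ A | x * (y * z) ∉ A}) (mul_left_injective y),
    ← card_image_of_injective ({x ∈ A | x * y ∉ A}) (mul_left_injective y)]
  refine (card_le_card ?_).trans (card_union_le _ _)
  intro w hw
  obtain ⟨x, hx, rfl⟩ := mem_image.1 hw
  obtain ⟨hxA, hx⟩ := mem_filter.1 hx
  rw [mem_union]
  by_cases h : x * y ∈ A
  · exact Or.inr (mem_filter.2 ⟨h, by rwa [mul_assoc]⟩)
  · exact Or.inl (mem_image_of_mem _ (mem_filter.2 ⟨hxA, h⟩))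

theorem rightGrowth_compl [Fintype G] (A : Finset G) (y : G) :
    rightGrowth Aᶜ y = rightGrowth A y := by
  rw [← rightGrowth_inv A]
  refine card_bij (fun x _ => x * y) ?_ (fun _ _ _ _ h => mul_right_cancel h) ?_
  · intro x hx
    have hx := mem_filter.1 hx
    simp only [mem_compl, not_not] at hx
    exact mem_filter.2 ⟨hx.2, by simpa using hx.1⟩
  · intro x hx
    have hx := mem_filter.1 hx
    exact ⟨x * y⁻¹, mem_filter.2 ⟨by simpa using hx.2, by simpa using hx.1⟩, by simp⟩

theorem card_mul_card_le_sum_rightGrowth (A Y : Finset G) :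
    #Y * #A ≤ ∑ y ∈ Y, rightGrowth A y + #A * #A := by
  have h1 : ∑ y ∈ Y, #{x ∈ A | x * y ∈ A} ≤ #A * #A := by
    rw [← card_sigma, ← card_product]
    refine card_le_card_of_injOn (fun q => (q.2, q.2 * q.1)) ?_ ?_
    · rintro ⟨y, x⟩ hq
      have hx := mem_filter.1 (mem_sigma.1 hq).2
      exact mem_product.2 hx
    · rintro ⟨y, x⟩ _ ⟨y', x'⟩ _ h
      simp only [Prod.mk.injEq] at h
      obtain ⟨rfl, h⟩ := h
      have := mul_left_cancel h
      subst this
      rfl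
  have h2 : ∑ y ∈ Y, (#{x ∈ A | x * y ∈ A} + rightGrowth A y) = #Y * #A := by
    rw [sum_congr rfl fun y _ => card_filter_add_rightGrowth A y, sum_const, smul_eq_mul]
  rw [sum_add_distrib] at h2
  omega

theorem exists_slowly_growing_set [Fintype G] {A D : Finset G} {μ : ℕ}
    (hD : ∀ d ∈ D, rightGrowth A d ≤ μ) (hgen : Subgroup.closure {d | rightGrowth A d ≤ μ} = ⊤)
    (N : ℕ) (hN : (N + 1) * #D ≤ Fintype.card G) :
    ∃ Y : Finset G, #Y = (N + 1) * #D ∧ (∀ y ∈ Y, rightGrowth A y ≤ (3 * N + 1) * μ) ∧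
      ∑ y ∈ Y, rightGrowth A y ≤ μ * #D * ∑ j ∈ range (N + 1), (3 * j + 1) := by
  induction N with
  | zero =>
    refine ⟨D, by simp, by simpa using hD, ?_⟩
    have := sum_le_card_nsmul D _ _ hD
    simpa [mul_comm] using this
  | succ N ih =>
    obtain ⟨Y, hY, hYb, hYs⟩ := ih (le_trans (Nat.mul_le_mul_right _ (by omega)) hN)
    suffices ∃ Z : Finset G, #Z = #D ∧ Disjoint Y Z ∧
        ∀ z ∈ Z, rightGrowth A z ≤ (3 * (N + 1) + 1) * μ by
      obtain ⟨Z, hZ, hYZ, hZb⟩ := this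
      refine ⟨Y ∪ Z, ?_, ?_, ?_⟩
      · rw [card_union_of_disjoint hYZ, hY, hZ]; ring
      · intro y hy
        rcases mem_union.1 hy with hy | hy
        · exact (hYb y hy).trans (Nat.mul_le_mul_right _ (by omega))
        · exact hZb y hy
      · rw [sum_union hYZ, sum_range_succ, mul_add]
        refine add_le_add hYs ?_
        have := sum_le_card_nsmul Z _ _ hZb
        rw [hZ, smul_eq_mul] at this
        refine this.trans (le_of_eq ?_)
        ring
    by_cases hz : ∃ z, (3 * N + 2) * μ < rightGrowth A z ∧ rightGrowth A z ≤ (3 * N + 3) * μ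
    · obtain ⟨z, hz1, hz2⟩ := hz
      refine ⟨D.image (z * ·), card_image_of_injective _ (mul_right_injective z), ?_, ?_⟩
      · rw [disjoint_right]
        intro w hw hwY
        obtain ⟨d, hd, rfl⟩ := mem_image.1 hw
        have h1 := hYb _ hwY
        have h2 := rightGrowth_mul_le A (z * d) d⁻¹
        have h3 := hD d hd
        rw [rightGrowth_inv, mul_inv_cancel_right] at h2
        have h4 : (3 * N + 2) * μ = (3 * N + 1) * μ + μ := by ring
        omega
      · intro w hw
        obtain ⟨d, hd, rfl⟩ := mem_image.1 hw
        have h2 := rightGrowth_mul_le A z d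
        have h3 := hD d hd
        have h4 : (3 * (N + 1) + 1) * μ = (3 * N + 3) * μ + μ := by ring
        omega
    · push Not at hz
      have hall : ∀ x : G, rightGrowth A x ≤ (3 * N + 2) * μ := by
        have hstep : ∀ x y : G, rightGrowth A x ≤ (3 * N + 2) * μ → rightGrowth A y ≤ μ →
            rightGrowth A (x * y) ≤ (3 * N + 2) * μ := by
          intro x y hx hy
          by_contra! hcon
          have h1 := hz _ hcon
          have h2 := rightGrowth_mul_le A x y
          have h4 : (3 * N + 3) * μ = (3 * N + 2) * μ + μ := by ring
          omega
        intro x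
        have hx : x ∈ Subgroup.closure {d | rightGrowth A d ≤ μ} := by rw [hgen]; trivial
        induction hx using Subgroup.closure_induction_right with
        | one => rw [rightGrowth_one]; omega
        | mul_right x _ y hy h => exact hstep x y h hy
        | mul_inv_cancel x _ y hy h =>
          exact hstep x y⁻¹ h (by rw [rightGrowth_inv]; exact hy)
      obtain ⟨Z, hZ, hZc⟩ := exists_subset_card_eq (s := Yᶜ) (n := #D) (by
        rw [card_compl, hY]
        have : (N + 1 + 1) * #D = (N + 1) * #D + #D := by ring
        omega)
      refine ⟨Z, hZc, ?_, fun z _ => (hall z).trans (Nat.mul_le_mul_right _ (by omega))⟩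
      rw [disjoint_right]
      exact fun z hz => mem_compl.1 (hZ hz)

theorem exists_rightGrowth_ge [Fintype G] {p : ℕ} (hp : 1 ≤ p) {A D : Finset G}
    (hA : 8 * p ≤ #A) (hA' : 2 * #A ≤ Fintype.card G) (hD : 8 * p ≤ #D)
    (hgen : Subgroup.closure (D : Set G) = ⊤) : ∃ d ∈ D, p ≤ rightGrowth A d := by
  by_contra! hcon
  obtain ⟨μ, rfl⟩ := Nat.exists_eq_add_of_le' hp
  have hD' : ∀ d ∈ D, rightGrowth A d ≤ μ := fun d hd => Nat.le_of_lt_succ (hcon d hd)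
  obtain ⟨E, hED, hE⟩ := exists_subset_card_eq hD
  have hgen' : Subgroup.closure {d | rightGrowth A d ≤ μ} = ⊤ :=
    top_le_iff.1 (hgen ▸ Subgroup.closure_mono fun d hd => hD' d hd)
  set β := 8 * (μ + 1) with hβ
  obtain ⟨N, hN1, hN2⟩ : ∃ N, (N + 2) * β ≤ 2 * #A ∧ 2 * #A < (N + 3) * β := by
    have h1 : 2 ≤ 2 * #A / β := (Nat.le_div_iff_mul_le (by omega)).2 (by omega)
    obtain ⟨N, hN⟩ := Nat.exists_eq_add_of_le' h1
    refine ⟨N, ?_, ?_⟩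
    · rw [← hN]; exact Nat.div_mul_le_self _ _
    · have := Nat.lt_div_mul_add (a := 2 * #A) (b := β) (by omega)
      rw [hN] at this
      linarith
  obtain ⟨Y, hY, -, hYs⟩ := exists_slowly_growing_set (fun d hd => hD' d (hED hd)) hgen' (N + 1)
    (by rw [hE]; exact hN1.trans hA')
  have h1 := card_mul_card_le_sum_rightGrowth A Y
  have hsum : ∀ N : ℕ, 2 * ∑ j ∈ range (N + 1 + 1), (3 * j + 1) = (N + 2) * (3 * N + 5) := by
    intro N
    induction N with
    | zero => simp [sum_range_succ]
    | succ N ih => rw [sum_range_succ, mul_add, ih]; ring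
  have hs := hsum N
  rw [hY, hE] at h1
  rw [hE] at hYs
  set x := #A
  set S := ∑ j ∈ range (N + 1 + 1), (3 * j + 1)
  have h2 : (N + 2) * β * x ≤ μ * β * S + x * x := by
    have : (N + 1 + 1) * β * x = (N + 2) * β * x := by ring
    omega
  have h3 : 2 * ((N + 2) * β * x) ≤ μ * β * ((N + 2) * (3 * N + 5)) + 2 * (x * x) := by
    rw [← hs]; linarith
  obtain ⟨y, hy⟩ := Nat.exists_eq_add_of_le hN1
  have hyβ : y < β := by
    have : (N + 3) * β = (N + 2) * β + β := by ring
    omega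
  have h4 : 4 * ((N + 2) * β * x) = 2 * ((N + 2) * β) * ((N + 2) * β + y) := by
    rw [← hy]; ring
  have h5 : 4 * (x * x) = ((N + 2) * β + y) * ((N + 2) * β + y) := by
    rw [← hy]; ring
  have h6 : y * y < β * β := Nat.mul_lt_mul'' hyβ hyβ
  have h7 : (N + 2) * β * ((N + 2) * β) < 2 * (μ * β * ((N + 2) * (3 * N + 5))) + β * β := by
    nlinarith
  have h8 : β * (2 * μ * ((N + 2) * (3 * N + 5)) + β) ≤ β * ((N + 2) * (N + 2) * β) := by
    apply Nat.mul_le_mul_left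
    rw [hβ]
    nlinarith [Nat.zero_le (μ * N), Nat.zero_le (μ * N * N), Nat.zero_le (N * N)]
  nlinarith

theorem exists_rightGrowth_of_many_values [Fintype G] {p : ℕ} (hp : 1 ≤ p) {X : Finset G}
    (hX : 8 * p ≤ #X) (hXc : 8 * p ≤ #Xᶜ) {R : Multiset G} (hR : OneProdFree R)
    (hinv : ∀ g ∈ R, g * g ≠ 1) (hcard : 4 * p ≤ #R.toFinset)
    (hgen : Subgroup.closure {g | g ∈ R} = ⊤) :
    ∃ b ∈ R, p ≤ #{x ∈ X | x * b ∉ X} := by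
  obtain ⟨A, hA, hA', hAX⟩ : ∃ A : Finset G, 8 * p ≤ #A ∧ 2 * #A ≤ Fintype.card G ∧
      ∀ y, rightGrowth A y = rightGrowth X y := by
    have := card_compl_add_card X
    rcases le_total #X #Xᶜ with h | h
    · exact ⟨X, hX, by omega, fun _ => rfl⟩
    · exact ⟨Xᶜ, hXc, by omega, rightGrowth_compl X⟩
  have hdisj : Disjoint R.toFinset (R.toFinset.image fun t => t⁻¹) := by
    rw [disjoint_right]
    intro y hy hy'
    obtain ⟨t, ht, rfl⟩ := mem_image.1 hy
    rw [Multiset.mem_toFinset] at ht hy'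
    by_cases htt : t = t⁻¹
    · exact hinv t ht (mul_eq_one_iff_eq_inv.2 htt)
    · have h1 : ((t :: t⁻¹ :: [] : List G) : Multiset G) ≤ R := by
        rw [Multiset.le_iff_subset]
        · intro z hz
          simp at hz
          rcases hz with rfl | rfl <;> assumption
        · simp [htt]
      have := oneProdFree_iff.1 hR _ h1 (by simp)
      simp at this
  obtain ⟨d, hd, hpd⟩ := exists_rightGrowth_ge hp hA hA'
    (D := R.toFinset ∪ R.toFinset.image fun t => t⁻¹)
    (by rw [card_union_of_disjoint hdisj, card_image_of_injective _ inv_injective]; omega)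
    (by
      rw [← top_le_iff, ← hgen]
      apply Subgroup.closure_mono
      intro g hg
      simp only [coe_union, Set.mem_union, mem_coe, Multiset.mem_toFinset]
      exact Or.inl hg)
  rw [hAX] at hpd
  rcases mem_union.1 hd with hd | hd
  · exact ⟨d, Multiset.mem_toFinset.1 hd, hpd⟩
  · obtain ⟨t, ht, rfl⟩ := mem_image.1 hd
    rw [rightGrowth_inv] at hpd
    exact ⟨t, Multiset.mem_toFinset.1 ht, hpd⟩

end SmallDavenport

namespace SmallDavenport

open scoped Pointwise Classical
open Finset
variable {G : Type*} [Group G] [Fintype G]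

theorem exists_le_card_eq {α : Type*} {M : Multiset α} {k : ℕ} (h : k ≤ Multiset.card M) :
    ∃ T ≤ M, Multiset.card T = k := by
  have h1 : Multiset.card (Multiset.powersetCard k M) ≠ 0 := by
    rw [Multiset.card_powersetCard]
    exact (Nat.choose_pos h).ne'
  rw [Ne, Multiset.card_eq_zero] at h1
  obtain ⟨T, hT⟩ := Multiset.exists_mem_of_ne_zero h1
  exact ⟨T, (Multiset.mem_powersetCard.1 hT).1, (Multiset.mem_powersetCard.1 hT).2⟩

theorem five_le_card_prodSet_pair {g h : G} (hg : g ≠ 1) (hh : h ≠ 1) (hgh : g * h ≠ h * g)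
    (h1 : g * h ≠ 1) : 5 ≤ #(prodSet ({g, h} : Multiset G)) := by
  have hne : g ≠ h := by rintro rfl; exact hgh rfl
  have h2 : h * g ≠ 1 := fun h3 => h1 (mul_eq_one_comm.1 h3)
  have hsub : ({1, g, h, g * h, h * g} : Finset G) ⊆ prodSet ({g, h} : Multiset G) := by
    intro x hx
    simp only [mem_insert, mem_singleton] at hx
    rcases hx with rfl | rfl | rfl | rfl | rfl
    · exact one_mem_prodSet _
    · exact mem_prodSet_of_mem (by simp)
    · exact mem_prodSet_of_mem (by simp)
    · exact mem_prodSet.2 ⟨[g, h], le_rfl, by simp⟩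
    · exact mem_prodSet.2 ⟨[h, g], le_of_eq (Multiset.pair_comm h g), by simp⟩
  refine le_trans (le_of_eq ?_) (card_le_card hsub)
  rw [card_insert_of_notMem, card_insert_of_notMem, card_insert_of_notMem,
    card_insert_of_notMem, card_singleton]
  all_goals simp [*, hg.symm, hh.symm, h1.symm, h2.symm]

theorem count_lt_orderOf {S : Multiset G} (hS : OneProdFree S) (g : G) :
    S.count g < orderOf g := by
  by_contra! h
  have h1 := oneProdFree_iff.1 hS (List.replicate (orderOf g) g)
    (by rw [Multiset.coe_replicate]; exact Multiset.le_count_iff_replicate_le.1 h)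
    (by simp [pow_orderOf_eq_one])
  have h2 := orderOf_pos g
  have h3 : (List.replicate (orderOf g) g).length = 0 := by rw [h1]; rfl
  simp at h3
  exact absurd h2 (by simp [h3])

omit [Group G] [Fintype G] in
theorem card_le_mul_card_toFinset {M : Multiset G} {c : ℕ} (h : ∀ g ∈ M, M.count g ≤ c) :
    Multiset.card M ≤ c * #M.toFinset := by
  rw [← Multiset.toFinset_sum_count_eq, mul_comm, ← smul_eq_mul]
  exact sum_le_card_nsmul _ _ _ fun g hg => h g (Multiset.mem_toFinset.1 hg)

theorem card_prodSet_le_card_compl_add_one {W R : Multiset G} (h : OneProdFree (W + R)) :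
    #(prodSet R) ≤ #(prodSet W)ᶜ + 1 := by
  have h1 : #((prodSet R).erase 1) ≤ #(prodSet W)ᶜ := by
    refine card_le_card_of_injOn (fun x => x⁻¹) ?_ inv_injective.injOn
    intro x hx
    have hx' := mem_erase.1 (mem_coe.1 hx)
    refine mem_coe.2 (mem_compl.2 fun hW => hx'.1 ?_)
    simpa using eq_one_of_mem_prodSet h hW hx'.2 (by simp)
  rw [card_erase_of_mem (one_mem_prodSet _)] at h1
  omega

theorem prime_orderOf_of_lt_sq {p : ℕ}
    (hmin : ∀ q : ℕ, q.Prime → q ∣ Fintype.card G → p ≤ q) {g : G} (hg : g ≠ 1)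
    (h : orderOf g < p * p) : (orderOf g).Prime := by
  have h1 : orderOf g ≠ 1 := fun h1 => hg (orderOf_eq_one_iff.1 h1)
  have h0 := orderOf_pos g
  have hm := Nat.minFac_prime h1
  have h2 := hmin _ hm ((Nat.minFac_dvd _).trans orderOf_dvd_card)
  by_contra hn
  have h3 := Nat.minFac_sq_le_self h0 hn
  have h4 : p * p ≤ (orderOf g).minFac ^ 2 := by rw [sq]; exact Nat.mul_le_mul h2 h2
  omega

/-- If every proper subgroup misses many terms of `R`, then some short subsequence of `R`
enlarges `Π(W)` by at least `p` elements per term, unless `Π(W)` is small. -/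
theorem exists_growing_block {p : ℕ} (hp : 2 ≤ p)
    (hmin : ∀ q : ℕ, q.Prime → q ∣ Fintype.card G → p ≤ q)
    (hG : Subgroup.center G ≠ ⊤) {W R : Multiset G} (hWR : OneProdFree (W + R))
    (hW : ∀ g : G, p - 1 ≤ Multiset.card (outside (Subgroup.zpowers g) W))
    (hR : ∀ K : Subgroup G, K ≠ ⊤ → 8 * p ^ 2 - 12 * p ≤ Multiset.card (outside K R))
    (hX : p * Multiset.card W + 1 ≤ #(prodSet W) + (p - 1) * (8 * p - 1)) :
    ∃ T ≤ R, T ≠ 0 ∧ Multiset.card T ≤ 2 * p - 1 ∧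
      p * Multiset.card (W + T) + 1 ≤ #(prodSet (W + T)) + (p - 1) * (8 * p - 1) := by
  have hRfree : OneProdFree R := hWR.mono (Multiset.le_add_left _ _)
  have hfree : ∀ T ≤ R, OneProdFree (W + T) := fun T hT => hWR.mono (add_le_add_right hT W)
  have hEp : 8 * p + (p - 2) * (8 * p - 4) = 8 * p ^ 2 - 12 * p + 8 := by
    obtain ⟨s, rfl⟩ := Nat.exists_eq_add_of_le' hp
    have : 12 * (s + 2) ≤ 8 * (s + 2) ^ 2 := by nlinarith
    zify [this, show 2 ≤ s + 2 by omega, show 4 ≤ 8 * (s + 2) by omega]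
    ring
  have hE1 : 8 * p - 8 ≤ 8 * p ^ 2 - 12 * p := by
    have := Nat.zero_le ((p - 2) * (8 * p - 4)); omega
  have hblock : ∀ T ≤ R, T ≠ 0 → Multiset.card T ≤ 2 * p - 1 →
      p * Multiset.card T + 1 ≤ #(prodSet T) →
      ∃ T ≤ R, T ≠ 0 ∧ Multiset.card T ≤ 2 * p - 1 ∧
      p * Multiset.card (W + T) + 1 ≤ #(prodSet (W + T)) + (p - 1) * (8 * p - 1) := by
    intro T h1 h2 h3 h4
    refine ⟨T, h1, h2, h3, ?_⟩
    have h5 := card_prodSet_add (hfree T h1)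
    rw [Multiset.card_add, mul_add]
    omega
  have hsingle : ∀ b ∈ R, #(prodSet W) + p ≤ #(prodSet (b ::ₘ W)) →
      ∃ T ≤ R, T ≠ 0 ∧ Multiset.card T ≤ 2 * p - 1 ∧
      p * Multiset.card (W + T) + 1 ≤ #(prodSet (W + T)) + (p - 1) * (8 * p - 1) := by
    intro b hb h1
    refine ⟨{b}, by simpa using hb, by simp, by simp; omega, ?_⟩
    rw [← Multiset.singleton_add, add_comm {b} W] at h1
    rw [Multiset.card_add, mul_add, Multiset.card_singleton]
    omega
  by_cases ha : #(prodSet W) < 8 * p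
  · have h1 := hR ⊥ (fun h => hG (by rw [eq_top_iff, ← h]; exact bot_le))
    have h2 : outside ⊥ R ≠ 0 := by
      intro h0
      rw [h0, Multiset.card_zero] at h1
      omega
    obtain ⟨b, hb⟩ := Multiset.exists_mem_of_ne_zero h2
    have hbR := (mem_outside.1 hb).1
    refine ⟨{b}, by simpa using hbR, by simp, by simp; omega, ?_⟩
    have h3 := card_lt_card_prodSet (hfree {b} (by simpa using hbR))
    have h4 := card_lt_card_prodSet (hfree 0 (by simp))
    rw [add_zero] at h4
    rw [Multiset.card_add, Multiset.card_singleton] at h3 ⊢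
    have h5 : (p - 1) * (Multiset.card W + 1) ≤ (p - 1) * (8 * p - 1) :=
      Nat.mul_le_mul_left _ (by omega)
    obtain ⟨s, rfl⟩ := Nat.exists_eq_add_of_le' hp
    simp only [show s + 2 - 1 = s + 1 by omega] at h5 ⊢
    nlinarith
  have hnoncentral : ∃ g ∈ R, g ∉ Subgroup.center G := by
    have h1 := hR _ hG
    have h2 : outside (Subgroup.center G) R ≠ 0 := by
      intro h0
      rw [h0, Multiset.card_zero] at h1
      omega
    obtain ⟨b, hb⟩ := Multiset.exists_mem_of_ne_zero h2
    exact ⟨b, mem_outside.1 hb⟩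
  have hcent : ∀ g, g ∉ Subgroup.center G → Subgroup.centralizer {g} ≠ ⊤ := by
    intro g hg h
    exact hg (Subgroup.mem_center_iff.2 fun x => by
      have hx : x ∈ Subgroup.centralizer {g} := by rw [h]; trivial
      exact (Subgroup.mem_centralizer_singleton_iff.1 hx))
  rcases hp.eq_or_lt with hp2 | hp3
  · subst hp2
    obtain ⟨g, hgR, hg⟩ := hnoncentral
    have h1 := hR _ (hcent g hg)
    have h2 : outside (Subgroup.centralizer {g}) R ≠ 0 := by
      intro h0
      rw [h0, Multiset.card_zero] at h1
      omega
    obtain ⟨h, hh⟩ := Multiset.exists_mem_of_ne_zero h2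
    obtain ⟨hhR, hh⟩ := mem_outside.1 hh
    have hcomm : g * h ≠ h * g := fun h3 =>
      hh (Subgroup.mem_centralizer_singleton_iff.2 h3.symm)
    have hne : g ≠ h := by rintro rfl; exact hcomm rfl
    have hT : ({g, h} : Multiset G) ≤ R := by
      refine (Multiset.le_iff_subset ?_).2 ?_
      · simpa using hne
      · intro x hx
        simp only [Multiset.insert_eq_cons, Multiset.mem_cons, Multiset.mem_singleton] at hx
        rcases hx with rfl | rfl <;> assumption
    refine hblock {g, h} hT (by simp) (by simp) ?_
    have := five_le_card_prodSet_pair (hRfree.ne_one hgR) (hRfree.ne_one hhR) hcomm (by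
      intro h1
      have := oneProdFree_iff.1 hRfree [g, h] hT (by simpa using h1)
      simp at this)
    simpa using this
  by_cases hc : ∃ g ∈ R, p * (p - 1) < orderOf g
  · obtain ⟨g, hg, hgo⟩ := hc
    obtain ⟨b, hb, h1 | h1⟩ := exists_growth_of_large_order hp hmin hWR hW
      (fun K hK => (by omega : p - 1 ≤ 8 * p ^ 2 - 12 * p).trans (hR K hK)) hg hgo
    · exact hsingle b hb ((Nat.add_le_add_left h1 _).trans
        (card_add_card_mul_right_notMem_le W b))
    · exact hsingle b hb ((Nat.add_le_add_left h1 _).trans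
        (card_add_card_mul_left_notMem_le W b))
  push Not at hc
  have hprime : ∀ g ∈ R, (orderOf g).Prime := fun g hg =>
    prime_orderOf_of_lt_sq hmin (hRfree.ne_one hg)
      (lt_of_le_of_lt (hc g hg) (Nat.mul_lt_mul_of_pos_left (by omega) (by omega)))
  by_cases hd : ∃ g ∈ R, g ∉ Subgroup.center G ∧ 2 * p - 2 ≤ R.count g
  · obtain ⟨g, hg, hgc, hcount⟩ := hd
    have hlt := count_lt_orderOf hRfree g
    by_cases hd1 : ∃ h ∈ R, h⁻¹ * g * h ∉ Subgroup.zpowers g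
    · obtain ⟨h, hh, hconj⟩ := hd1
      have hne : h ≠ g := by
        rintro rfl
        exact hconj (by simp)
      have hT : h ::ₘ Multiset.replicate (2 * p - 2) g ≤ R := by
        rw [Multiset.le_iff_count]
        intro x
        rw [Multiset.count_cons, Multiset.count_replicate]
        by_cases hx : x = h
        · subst hx
          simpa [hne.symm] using Multiset.one_le_count_iff_mem.2 hh
        · by_cases hxg : x = g
          · subst hxg
            simpa [hx] using hcount
          · simp [hx, Ne.symm hxg]
      refine hblock _ hT (by simp) (by simp; omega) ?_
      have := card_prodSet_of_conj_notMem rfl (hprime g hg) (N := 2 * p - 2) (by omega) hconj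
      refine le_trans (le_of_eq ?_) this
      obtain ⟨s, rfl⟩ := Nat.exists_eq_add_of_le' hp
      simp only [Multiset.card_cons, Multiset.card_replicate]
      rw [show 2 * (s + 2) - 2 = 2 * s + 2 by omega,
        show (2 * s + 2 + 1) * (2 * s + 2 + 2) = (s + 2) * (2 * s + 2 + 1) * 2 by ring,
        Nat.mul_div_cancel _ (by norm_num)]
    · push Not at hd1
      obtain ⟨L, hL, hLc⟩ := exists_le_card_eq (M := outside (Subgroup.centralizer {g}) R)
        (k := p - 1) ((by omega : p - 1 ≤ 8 * p ^ 2 - 12 * p).trans (hR _ (hcent g hgc)))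
      have hLm : ∀ h ∈ L, h ∈ R ∧ h * g ≠ g * h := by
        intro h hh
        obtain ⟨h1, h2⟩ := mem_outside.1 (Multiset.mem_of_le hL hh)
        exact ⟨h1, fun h3 => h2 (Subgroup.mem_centralizer_singleton_iff.2 h3)⟩
      have hT : L + Multiset.replicate (p - 1) g ≤ R := by
        rw [Multiset.le_iff_count]
        intro x
        rw [Multiset.count_add, Multiset.count_replicate]
        by_cases hx : g = x
        · subst hx
          have : L.count g = 0 := Multiset.count_eq_zero.2 fun h => (hLm g h).2 rfl
          rw [this, if_pos rfl]
          omega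
        · simpa [hx] using Multiset.count_le_of_le x (hL.trans (outside_le _ R))
      have hcard : Multiset.card (L + Multiset.replicate (p - 1) g) = 2 * p - 2 := by
        rw [Multiset.card_add, hLc, Multiset.card_replicate]; omega
      refine hblock _ hT (fun h0 => ?_) (by omega) ?_
      · rw [h0, Multiset.card_zero] at hcard; omega
      · rw [hcard]
        exact card_prodSet_of_conj_mem hp hmin rfl (hprime g hg) (by omega) hLc.ge
          (fun h hh => hd1 h (hLm h hh).1) fun h hh => (hLm h hh).2
  · push Not at hd
    have hvals : 4 * p ≤ #R.toFinset := by
      have h1 := card_le_mul_card_toFinset (M := outside (Subgroup.center G) R) (c := 2 * p - 3)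
        (by
          intro g hg
          have h2 := hd g (mem_outside.1 hg).1 (mem_outside.1 hg).2
          have h3 := Multiset.count_le_of_le g (outside_le (Subgroup.center G) R)
          omega)
      have h2 := (hR _ hG).trans h1
      have h3 : #(outside (Subgroup.center G) R).toFinset ≤ #R.toFinset :=
        card_le_card (Multiset.toFinset_subset.2 (Multiset.subset_of_le (outside_le _ R)))
      refine le_trans ?_ h3
      have h4 : 8 * p ^ 2 - 12 * p = (2 * p - 3) * (4 * p) := by
        rw [Nat.sub_mul]
        congr 1 <;> ring
      rw [h4] at h2
      exact Nat.le_of_mul_le_mul_left h2 (by omega)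
    have hgen : Subgroup.closure {g | g ∈ R} = ⊤ := by
      by_contra hK
      have h1 := hR _ hK
      have h2 : outside (Subgroup.closure {g | g ∈ R}) R = 0 := by
        refine Multiset.eq_zero_of_forall_notMem fun g hg => ?_
        exact (mem_outside.1 hg).2 (Subgroup.subset_closure (mem_outside.1 hg).1)
      rw [h2, Multiset.card_zero] at h1
      omega
    have hinv : ∀ g ∈ R, g * g ≠ 1 := by
      intro g hg h1
      have h2 : orderOf g ∣ 2 := orderOf_dvd_of_pow_eq_one (by rw [sq, h1])
      have h3 := hmin _ (hprime g hg) orderOf_dvd_card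
      have := Nat.le_of_dvd (by norm_num) h2
      omega
    have hXc : 8 * p ≤ #(prodSet W)ᶜ := by
      have h1 := card_prodSet_le_card_compl_add_one hWR
      have h2 := card_lt_card_prodSet hRfree
      have h3 := (hR _ hG).trans (Multiset.card_le_card (outside_le _ R))
      have h4 : 1 * 20 ≤ (p - 2) * (8 * p - 4) := Nat.mul_le_mul (by omega) (by omega)
      omega
    obtain ⟨b, hb, h1⟩ := exists_rightGrowth_of_many_values (by omega) (not_lt.1 ha) hXc hRfree
      hinv hvals hgen
    exact hsingle b hb ((Nat.add_le_add_left h1 _).trans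
        (card_add_card_mul_right_notMem_le W b))

end SmallDavenport

namespace SmallDavenport

open scoped Pointwise Classical
open Finset
variable {G : Type*} [Group G] [Fintype G]

omit [Fintype G] in
theorem filter_add_outside (K : Subgroup G) (S : Multiset G) :
    S.filter (· ∈ K) + outside K S = S := Multiset.filter_add_not _ _

omit [Fintype G] in
theorem outside_add (K : Subgroup G) (S T : Multiset G) :
    outside K (S + T) = outside K S + outside K T := Multiset.filter_add _ _ _

omit [Fintype G] in
theorem card_outside_le (K : Subgroup G) (S : Multiset G) :
    Multiset.card (outside K S) ≤ Multiset.card S := Multiset.card_le_card (outside_le K S)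

theorem card_add_one_le_card_subgroup {S : Multiset G} (hS : OneProdFree S) {K : Subgroup G}
    (h : ∀ g ∈ S, g ∈ K) : Multiset.card S + 1 ≤ Nat.card K :=
  (card_lt_card_prodSet hS).trans (card_prodSet_le_of_subgroup K h)

omit [Fintype G] in
theorem exists_spread_subsequence {S : Multiset G} (hG : Subgroup.center G ≠ ⊤) {j : ℕ}
    (hS : ∀ K : Subgroup G, K ≠ ⊤ → 2 * j ≤ Multiset.card (outside K S) + 1) :
    ∃ W R : Multiset G, W + R = S ∧ Multiset.card W = 2 * j ∧
      ∀ g : G, j ≤ Multiset.card (outside (Subgroup.zpowers g) W) := by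
  induction j with
  | zero => exact ⟨0, S, by simp, by simp, by simp⟩
  | succ j ih =>
    obtain ⟨W, R, rfl, hc, hW⟩ := ih fun K hK => by have := hS K hK; omega
    have hmiss : ∀ K : Subgroup G, K ≠ ⊤ → ∃ g ∈ R, g ∉ K := by
      intro K hK
      have h1 := hS K hK
      rw [outside_add, Multiset.card_add] at h1
      have h2 := card_outside_le K W
      obtain ⟨g, hg⟩ := Multiset.card_pos_iff_exists_mem.1
        (by omega : 0 < Multiset.card (outside K R))
      exact ⟨g, mem_outside.1 hg⟩
    obtain ⟨g, hg, hgc⟩ := hmiss _ hG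
    obtain ⟨h, hh, hhg⟩ := hmiss (Subgroup.centralizer {g}) (by
      intro h
      exact hgc (Subgroup.mem_center_iff.2 fun x => by
        have hx : x ∈ Subgroup.centralizer {g} := by rw [h]; trivial
        exact (Subgroup.mem_centralizer_singleton_iff.1 hx)))
    have hcomm : h * g ≠ g * h := fun h1 => hhg (Subgroup.mem_centralizer_singleton_iff.2 h1)
    have hne : h ≠ g := by rintro rfl; exact hcomm rfl
    obtain ⟨R', rfl⟩ := Multiset.exists_cons_of_mem hg
    obtain ⟨R'', rfl⟩ := Multiset.exists_cons_of_mem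
      ((Multiset.mem_cons.1 hh).resolve_left hne)
    refine ⟨W + {g, h}, R'', ?_, by simp [hc]; omega, fun x => ?_⟩
    · rw [add_assoc, Multiset.insert_eq_cons, Multiset.cons_add, Multiset.singleton_add]
    · rw [outside_add, Multiset.card_add]
      have h1 : 0 < Multiset.card (outside (Subgroup.zpowers x) ({g, h} : Multiset G)) := by
        by_contra h0
        have h0' := Multiset.card_eq_zero.1 (Nat.eq_zero_of_not_pos h0)
        have hz : ∀ y ∈ ({g, h} : Multiset G), y ∈ Subgroup.zpowers x := by
          intro y hy
          by_contra hy'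
          have := mem_outside.2 ⟨hy, hy'⟩
          rw [h0'] at this
          simp at this
        obtain ⟨a, rfl⟩ := hz g (by simp)
        obtain ⟨b, rfl⟩ := hz h (by simp)
        exact hcomm (by simp only [← zpow_add, add_comm])
      have := hW x
      omega

theorem card_le_of_noncomm {p q : ℕ} (hp : 2 ≤ p) (hq : Fintype.card G = p * q)
    (hmin : ∀ q : ℕ, q.Prime → q ∣ Fintype.card G → p ≤ q)
    (hG : Subgroup.center G ≠ ⊤) {S : Multiset G} (hS : OneProdFree S) :
    Multiset.card S + 10 * p ≤ q + 9 * p ^ 2 := by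
  obtain ⟨E, hE⟩ : ∃ E, E = 8 * p ^ 2 - 12 * p := ⟨_, rfl⟩
  have hp2 : 2 * p ≤ p ^ 2 := by nlinarith
  have hsub : ∀ K : Subgroup G, K ≠ ⊤ → Nat.card K ≤ q := by
    intro K hK
    have h1 := card_subgroup_le hmin hK
    rw [hq, mul_comm] at h1
    exact Nat.le_of_mul_le_mul_left h1 (by omega)
  by_cases hA : ∃ K : Subgroup G, K ≠ ⊤ ∧ Multiset.card (outside K S) < E
  · obtain ⟨K, hK, h1⟩ := hA
    have h2 := card_add_one_le_card_subgroup (hS.mono (Multiset.filter_le (· ∈ K) S))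
      (K := K) fun g hg => (Multiset.mem_filter.1 hg).2
    have h3 := congrArg Multiset.card (filter_add_outside K S)
    rw [Multiset.card_add] at h3
    have h4 := hsub K hK
    omega
  push Not at hA
  have key : ∀ k : ℕ, ∀ W R : Multiset G, Multiset.card R = k → W + R = S →
      p * Multiset.card W + 1 ≤ #(prodSet W) + (p - 1) * (8 * p - 1) →
      (∀ g : G, p - 1 ≤ Multiset.card (outside (Subgroup.zpowers g) W)) →
      (∀ K : Subgroup G, K ≠ ⊤ → E ≤ Multiset.card (outside K R) + (2 * p - 1)) →
      Multiset.card S + 10 * p ≤ q + 9 * p ^ 2 := by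
    intro k
    induction k using Nat.strong_induction_on with
    | _ k ih =>
    intro W R hk hWR hX hW hR
    by_cases hB : ∃ K : Subgroup G, K ≠ ⊤ ∧ Multiset.card (outside K R) < E
    · obtain ⟨K, hK, h1⟩ := hB
      obtain ⟨T, hT, hTc⟩ := exists_le_card_eq (M := outside K R) (k := p - 1)
        (by have := hR K hK; omega)
      have h2 := min_le_card_cosets hmin (K := K) (T := T)
        fun t ht => (mem_outside.1 (Multiset.mem_of_le hT ht)).2
      rw [hTc, Nat.sub_add_cancel (by omega), min_self] at h2
      have h3 := mul_card_le_card_prodSet_add (K := K) T (R.filter (· ∈ K))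
        fun g hg => (Multiset.mem_filter.1 hg).2
      have hle : T + R.filter (· ∈ K) ≤ R := by
        conv_rhs => rw [← filter_add_outside K R, add_comm]
        exact add_le_add_left hT _
      have hfree : OneProdFree (W + (T + R.filter (· ∈ K))) :=
        hS.mono (by rw [← hWR]; exact add_le_add_right hle W)
      have h4 := card_prodSet_add hfree
      have h5 : #(prodSet (W + (T + R.filter (· ∈ K)))) ≤ p * q := by
        rw [← hq]; exact card_le_univ _
      have h6 := card_lt_card_prodSet (S := R.filter (· ∈ K)) (hfree.mono
        ((Multiset.le_add_left _ _).trans (Multiset.le_add_left _ _)))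
      have h7 : p * (Multiset.card (R.filter (· ∈ K)) + 1) ≤
          #(prodSet (T + R.filter (· ∈ K))) := (Nat.mul_le_mul h2 h6).trans h3
      have h8 := congrArg Multiset.card (filter_add_outside K R)
      have h9 := congrArg Multiset.card hWR
      rw [Multiset.card_add] at h8 h9
      have h10 : p * (Multiset.card W + Multiset.card (R.filter (· ∈ K)) + 1) <
          p * (q + (8 * p - 8)) := by
        obtain ⟨s, rfl⟩ := Nat.exists_eq_add_of_le' hp
        have e1 : s + 2 - 1 = s + 1 := by omega
        have e2 : 8 * (s + 2) - 1 = 8 * s + 15 := by omega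
        have e3 : 8 * (s + 2) - 8 = 8 * s + 8 := by omega
        rw [e1, e2] at hX
        rw [e3]
        nlinarith
      have h11 := Nat.lt_of_mul_lt_mul_left h10
      have h12 : 6 * p ≤ p ^ 2 + 9 := by
        zify; nlinarith [sq_nonneg ((p : ℤ) - 3)]
      omega
    · push Not at hB
      obtain ⟨T, hT, hT0, hTc, hTX⟩ := exists_growing_block hp hmin hG (hWR ▸ hS) hW
        (fun K hK => hE ▸ hB K hK) hX
      obtain ⟨R', rfl⟩ := Multiset.le_iff_exists_add.1 hT
      have hTpos := Multiset.card_pos.2 hT0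
      rw [Multiset.card_add] at hk
      refine ih (Multiset.card R') (by omega) (W + T) R' rfl (by rw [add_assoc, hWR]) hTX ?_ ?_
      · intro g
        rw [outside_add, Multiset.card_add]
        exact (hW g).trans (Nat.le_add_right _ _)
      · intro K hK
        have h1 := hB K hK
        rw [outside_add, Multiset.card_add] at h1
        have h2 := card_outside_le K T
        omega
  obtain ⟨W, R, hWR, hWc, hW⟩ := exists_spread_subsequence (S := S) hG (j := p - 1)
    (fun K hK => by have := hA K hK; omega)
  refine key _ W R rfl hWR ?_ hW ?_
  · have h1 : 0 < #(prodSet W) := card_pos.2 ⟨1, one_mem_prodSet W⟩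
    have h2 : p * (2 * (p - 1)) ≤ (p - 1) * (8 * p - 1) := by
      rw [show p * (2 * (p - 1)) = (p - 1) * (2 * p) by ring]
      exact Nat.mul_le_mul_left _ (by omega)
    rw [hWc]
    omega
  · intro K hK
    have h1 := hA K hK
    rw [← hWR, outside_add, Multiset.card_add] at h1
    have h2 := card_outside_le K W
    omega

end SmallDavenport

namespace SmallDavenport

open scoped Pointwise Classical
open Finset

theorem exists_zero_sum_finset {q r : ℕ} [Fact q.Prime] {ι : Type*} [Fintype ι]
    (f : ι → Fin r → ZMod q) (h : r * (q - 1) < Fintype.card ι) :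
    ∃ s : Finset ι, s.Nonempty ∧ ∑ i ∈ s, f i = 0 := by
  have hq : 2 ≤ q := (Fact.out : q.Prime).two_le
  let P : Fin r → MvPolynomial ι (ZMod q) := fun k =>
    ∑ i, MvPolynomial.C (f i k) * MvPolynomial.X i ^ (q - 1)
  have hdeg : ∀ k, (P k).totalDegree ≤ q - 1 := by
    intro k
    refine MvPolynomial.totalDegree_finsetSum_le fun i _ => ?_
    refine (MvPolynomial.totalDegree_mul _ _).trans ?_
    rw [MvPolynomial.totalDegree_C, MvPolynomial.totalDegree_X_pow, zero_add]
  have hsum : (∑ k, (P k).totalDegree) < Fintype.card ι := by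
    refine lt_of_le_of_lt (sum_le_card_nsmul _ _ (q - 1) fun k _ => hdeg k) ?_
    simpa using h
  have hdvd := char_dvd_card_solutions_of_fintype_sum_lt q hsum
  rw [Fintype.card_eq_nat_card] at hdvd
  have heval : ∀ (x : ι → ZMod q) k, MvPolynomial.eval x (P k) = ∑ i, f i k * x i ^ (q - 1) := by
    intro x k
    simp [P]
  have hzero : ∀ k, MvPolynomial.eval (0 : ι → ZMod q) (P k) = 0 := by
    intro k
    rw [heval]
    exact sum_eq_zero fun i _ => by simp [zero_pow (by omega : q - 1 ≠ 0)]
  have hcard : 1 < Fintype.card {x : ι → ZMod q // ∀ k, MvPolynomial.eval x (P k) = 0} := by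
    rw [Fintype.card_eq_nat_card]
    have : Nonempty {x : ι → ZMod q // ∀ k, MvPolynomial.eval x (P k) = 0} := ⟨⟨0, hzero⟩⟩
    exact (show 1 < q by omega).trans_le (Nat.le_of_dvd Nat.card_pos hdvd)
  obtain ⟨⟨x, hx⟩, hne⟩ := Fintype.exists_ne_of_one_lt_card hcard ⟨0, hzero⟩
  have hx0 : x ≠ 0 := fun h => hne (Subtype.ext h)
  obtain ⟨j, hj⟩ := Function.ne_iff.1 hx0
  refine ⟨univ.filter fun i => x i ≠ 0, ⟨j, by simpa using hj⟩, ?_⟩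
  ext k
  have h1 := hx k
  rw [heval] at h1
  rw [Finset.sum_apply, sum_filter, Pi.zero_apply]
  refine Eq.trans ?_ h1
  refine sum_congr rfl fun i _ => ?_
  by_cases hi : x i = 0
  · simp [hi, zero_pow (by omega : q - 1 ≠ 0)]
  · simp [hi, ZMod.pow_card_sub_one_eq_one hi]

theorem exists_zero_sum {q r : ℕ} [Fact q.Prime] {α : Type*} {M : Multiset α}
    (f : α → Fin r → ZMod q) (h : r * (q - 1) < Multiset.card M) :
    ∃ T ≤ M, T ≠ 0 ∧ (T.map f).sum = 0 := by
  obtain ⟨s, hs, hsum⟩ := exists_zero_sum_finset (q := q) (ι := Fin M.toList.length)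
    (fun i => f (M.toList.get i)) (by simpa using h)
  refine ⟨s.val.map M.toList.get, ?_, ?_, ?_⟩
  · have h1 : (univ : Finset (Fin M.toList.length)).val.map M.toList.get = M := by
      rw [Fin.univ_val_map, List.ofFn_get, Multiset.coe_toList]
    conv_rhs => rw [← h1]
    exact Multiset.map_le_map (Finset.val_le_iff.2 (subset_univ s))
  · simpa using hs.ne_empty
  · rw [Multiset.map_map]
    exact hsum

theorem exists_short_zero_sum {q : ℕ} [Fact q.Prime] {α : Type*} {M : Multiset α}
    (f : α → Fin 2 → ZMod q) (h : 3 * q - 2 ≤ Multiset.card M) :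
    ∃ T ≤ M, T ≠ 0 ∧ Multiset.card T ≤ q ∧ (T.map f).sum = 0 := by
  have hq : 2 ≤ q := (Fact.out : q.Prime).two_le
  obtain ⟨M', hM', hc⟩ := exists_le_card_eq h
  obtain ⟨T, hT, hT0, hsum⟩ := exists_zero_sum (q := q) (M := M')
    (fun a => (![f a 0, f a 1, 1] : Fin 3 → ZMod q)) (by omega)
  have hcomp : ∀ U : Multiset α, (U.map fun a => (![f a 0, f a 1, 1] : Fin 3 → ZMod q)).sum =
      ![(U.map f).sum 0, (U.map f).sum 1, (Multiset.card U : ZMod q)] := by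
    intro U
    induction U using Multiset.induction with
    | empty => ext k; fin_cases k <;> simp
    | cons a U ih =>
      rw [Multiset.map_cons, Multiset.sum_cons, ih]
      ext k
      fin_cases k <;> simp [add_comm]
  rw [hcomp] at hsum
  have hf : (T.map f).sum = 0 := by
    ext k
    fin_cases k
    · simpa using congrFun hsum 0
    · simpa using congrFun hsum 1
  have hdvd : q ∣ Multiset.card T := by
    rw [← ZMod.natCast_eq_zero_iff]
    simpa using congrFun hsum 2
  have hle := Multiset.card_le_card hT
  have hpos := Multiset.card_pos.2 hT0
  obtain ⟨c, hTc⟩ := hdvd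
  have hc3 : c < 3 := by
    by_contra! h3
    have := Nat.mul_le_mul_left q h3
    omega
  interval_cases c
  · omega
  · exact ⟨T, hT.trans hM', hT0, by omega, hf⟩
  · obtain ⟨T₁, hT₁, hc₁⟩ := exists_le_card_eq (M := T) (k := 2 * q - 1) (by omega)
    obtain ⟨U, hU, hU0, hUsum⟩ := exists_zero_sum (q := q) (M := T₁) f (by omega)
    have hUc := Multiset.card_le_card hU
    have hUpos := Multiset.card_pos.2 hU0
    obtain ⟨V, rfl⟩ := Multiset.le_iff_exists_add.1 (hU.trans hT₁)
    rw [Multiset.card_add] at hTc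
    by_cases hUq : Multiset.card U ≤ q
    · exact ⟨U, hU.trans (hT₁.trans (hT.trans hM')), hU0, hUq, hUsum⟩
    · refine ⟨V, (Multiset.le_add_left _ _).trans (hT.trans hM'), ?_, by omega, ?_⟩
      · rw [← Multiset.card_pos]; omega
      · rw [Multiset.map_add, Multiset.sum_add, hUsum, zero_add] at hf
        exact hf

variable {G : Type*} [CommGroup G]

theorem oneProdFree_iff_of_comm {S : Multiset G} :
    OneProdFree S ↔ ∀ U ≤ S, U.prod = 1 → U = 0 := by
  rw [oneProdFree_iff]
  constructor
  · intro h U hU h1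
    have := h U.toList (by simpa using hU) (by simpa using h1)
    simpa using this
  · intro h l hl h1
    simpa using h l hl (by simpa using h1)

theorem exists_blocks_in_ker {q : ℕ} [Fact q.Prime] (φ : G →* Multiplicative (Fin 2 → ZMod q))
    (k : ℕ) {S : Multiset G} (hS : OneProdFree S) (hk : q * k + (2 * q - 2) ≤ Multiset.card S) :
    ∃ B : Multiset G, Multiset.card B = k ∧ (∀ g ∈ B, g ∈ φ.ker) ∧ OneProdFree B := by
  have hq : 2 ≤ q := (Fact.out : q.Prime).two_le
  suffices h : ∃ B : Multiset G, Multiset.card B = k ∧ (∀ g ∈ B, g ∈ φ.ker) ∧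
      ∀ U ≤ B, ∃ V ≤ S, V.prod = U.prod ∧ (U ≠ 0 → V ≠ 0) by
    obtain ⟨B, h1, h2, h3⟩ := h
    refine ⟨B, h1, h2, oneProdFree_iff_of_comm.2 fun U hU hU1 => ?_⟩
    obtain ⟨V, hV, hVU, h0⟩ := h3 U hU
    by_contra hne
    exact h0 hne (oneProdFree_iff_of_comm.1 hS V hV (hVU.trans hU1))
  clear hS
  induction k generalizing S with
  | zero => exact ⟨0, rfl, by simp, fun U hU => ⟨0, by simp, by simp_all⟩⟩
  | succ k ih =>
    rw [mul_add, mul_one] at hk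
    obtain ⟨T, hT, hT0, hTc, hsum⟩ := exists_short_zero_sum (q := q) (M := S)
      (fun g => (φ g).toAdd) (by have := Nat.zero_le (q * k); omega)
    obtain ⟨S', rfl⟩ := Multiset.le_iff_exists_add.1 hT
    rw [Multiset.card_add] at hk
    obtain ⟨B, hB, hBk, hBS⟩ := ih (S := S') (by omega)
    refine ⟨T.prod ::ₘ B, by simp [hB], ?_, ?_⟩
    · intro g hg
      rcases Multiset.mem_cons.1 hg with rfl | hg
      · have hprod : ∀ U : Multiset G, (U.map fun g => (φ g).toAdd).sum = (φ U.prod).toAdd := by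
          intro U
          induction U using Multiset.induction with
          | empty => simp
          | cons a U ih => simp [ih]
        rw [hprod] at hsum
        exact MonoidHom.mem_ker.2 (Multiplicative.toAdd.injective hsum)
      · exact hBk g hg
    · intro U hU
      by_cases hmem : T.prod ∈ U
      · obtain ⟨U', rfl⟩ := Multiset.exists_cons_of_mem hmem
        obtain ⟨V, hV, hVU, -⟩ := hBS U' ((Multiset.cons_le_cons_iff _).1 hU)
        refine ⟨T + V, add_le_add_right hV T, by simp [hVU], fun _ h0 => hT0 ?_⟩
        simp_all
      · obtain ⟨V, hV, hVU, h0⟩ := hBS U ((Multiset.le_cons_of_notMem hmem).1 hU)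
        exact ⟨V, hV.trans (Multiset.le_add_left _ _), hVU, h0⟩

theorem exists_surjective_of_not_isCyclic [Finite G] (hG : ¬ IsCyclic G) :
    ∃ q : ℕ, q.Prime ∧ ∃ φ : G →* Multiplicative (Fin 2 → ZMod q), Function.Surjective φ := by
  obtain ⟨ι, _, n, hn, ⟨e⟩⟩ := CommGroup.equiv_prod_multiplicative_zmod_of_finite G
  by_cases hco : Pairwise (Function.onFun Nat.Coprime n)
  · exfalso
    refine hG ?_
    let e' : G ≃* Multiplicative (ZMod (∏ i, n i)) := e.trans
      ((MulEquiv.piMultiplicative fun i => ZMod (n i)).symm.trans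
        (ZMod.prodEquivPi n hco).symm.toAddEquiv.toMultiplicative)
    exact (MulEquiv.isCyclic e').2 inferInstance
  · simp only [Pairwise, Function.onFun, not_forall] at hco
    obtain ⟨i, j, hij, hc⟩ := hco
    obtain ⟨q, hq, hqi, hqj⟩ := Nat.Prime.not_coprime_iff_dvd.1 hc
    refine ⟨q, hq, ?_⟩
    let ψ : (∀ i, Multiplicative (ZMod (n i))) →* Multiplicative (Fin 2 → ZMod q) :=
      { toFun := fun x => Multiplicative.ofAdd
          ![ZMod.castHom hqi (ZMod q) (x i).toAdd, ZMod.castHom hqj (ZMod q) (x j).toAdd]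
        map_one' := by
          rw [← ofAdd_zero]
          congr 1
          ext k
          fin_cases k <;> simp
        map_mul' := by
          intro x y
          rw [← ofAdd_add]
          congr 1
          ext k
          fin_cases k <;> simp only [Pi.mul_apply, toAdd_mul, map_add] <;> rfl }
    have hψ : Function.Surjective ψ := ?_
    · exact ⟨ψ.comp e.toMonoidHom, hψ.comp e.surjective⟩
    intro y
    obtain ⟨a, ha⟩ := ZMod.castHom_surjective hqi (y.toAdd 0)
    obtain ⟨b, hb⟩ := ZMod.castHom_surjective hqj (y.toAdd 1)
    refine ⟨Function.update (Function.update 1 i (Multiplicative.ofAdd a)) j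
      (Multiplicative.ofAdd b), Multiplicative.toAdd.injective ?_⟩
    ext k
    fin_cases k
    · simpa [ψ, Function.update_of_ne hij] using ha
    · simpa [ψ] using hb

theorem card_le_of_comm [Fintype G] {p m : ℕ} (hp : p.Prime) (hm : Fintype.card G = p * m)
    (hmin : ∀ q : ℕ, q.Prime → q ∣ Fintype.card G → p ≤ q) (hG : ¬ IsCyclic G)
    {S : Multiset G} (hS : OneProdFree S) :
    Multiset.card S + 10 * p ≤ m + 9 * p ^ 2 := by
  obtain ⟨q, hq, φ, hφ⟩ := exists_surjective_of_not_isCyclic hG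
  have : Fact q.Prime := ⟨hq⟩
  have hp2 := hp.two_le
  have hcard : p * m = q ^ 2 * Nat.card φ.ker := by
    have h1 := φ.ker.card_mul_index
    rw [Subgroup.index_ker, MonoidHom.range_eq_top.2 hφ, Subgroup.card_top,
      Nat.card_eq_fintype_card (α := G), hm] at h1
    rw [← h1, mul_comm]
    congr 1
    simp
  have hbound : Multiset.card S < q * Nat.card φ.ker + (2 * q - 2) := by
    by_contra! h
    obtain ⟨B, hB, hBk, hBf⟩ := exists_blocks_in_ker φ _ hS h
    have := card_add_one_le_card_subgroup hBf hBk
    omega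
  have hpq : p ≤ q := hmin q hq (by
    rw [hm, hcard]; exact Dvd.dvd.mul_right (dvd_pow_self q two_ne_zero) _)
  have hq2 := hq.two_le
  rcases hpq.eq_or_lt with rfl | hlt
  · have h1 : m = p * Nat.card φ.ker := by
      rw [sq, mul_assoc] at hcard
      exact Nat.eq_of_mul_eq_mul_left hp.pos hcard
    rw [← h1] at hbound
    nlinarith [Nat.sub_add_cancel (show 2 ≤ 2 * p by omega)]
  · have hdvd : p ∣ Nat.card φ.ker := by
      have h1 : p ∣ q ^ 2 * Nat.card φ.ker := hcard ▸ Dvd.intro _ rfl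
      rcases hp.dvd_mul.1 h1 with h2 | h2
      · have := (Nat.prime_dvd_prime_iff_eq hp hq).1 (hp.dvd_of_dvd_pow h2)
        omega
      · exact h2
    obtain ⟨k, hk⟩ := hdvd
    rw [hk] at hcard hbound
    have h1 : m = q ^ 2 * k := by
      rw [mul_left_comm] at hcard
      exact Nat.eq_of_mul_eq_mul_left hp.pos hcard
    have hkpos : 1 ≤ k := by
      rcases Nat.eq_zero_or_pos k with rfl | h
      · have := Nat.card_pos (α := φ.ker)
        omega
      · exact h
    obtain ⟨d, rfl⟩ := Nat.exists_eq_add_of_le hlt.le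
    have hd : 1 ≤ d := by omega
    have h2 : (p + d) ^ 2 * k = (p + d) * (p * k) + (p + d) * d * k := by ring
    have h3 : (p + d) * d ≤ (p + d) * d * k := Nat.le_mul_of_pos_right _ hkpos
    have h4 : 2 * p ≤ p ^ 2 := by nlinarith
    have h5 : 2 * (p + d) ≤ (p + d) * d + p + 1 := by nlinarith
    rw [h1, h2]
    omega

end SmallDavenport

/-- Let `G` be a finite noncyclic group of order `n` and let `p` be the smallest
prime divisor of `n`. Then `d(G) ≤ n / p + 9 p ^ 2 - 10 p`. -/
theorem smallDavenport_le {G : Type*} [Group G] [Fintype G] (hG : ¬ IsCyclic G)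
    (p : ℕ) (hp : p.Prime) (hpn : p ∣ Fintype.card G)
    (hmin : ∀ q : ℕ, q.Prime → q ∣ Fintype.card G → p ≤ q) :
    smallDavenport G ≤ Fintype.card G / p + 9 * p ^ 2 - 10 * p := by
  refine csSup_le ⟨0, 0, ?_, rfl⟩ ?_
  · rw [SmallDavenport.oneProdFree_iff]
    intro l hl _
    simpa using hl
  rintro _ ⟨S, hS, rfl⟩
  obtain ⟨m, hm⟩ := hpn
  rw [hm, Nat.mul_div_cancel_left m hp.pos]
  refine Nat.le_sub_of_add_le ?_
  by_cases hc : Subgroup.center G = ⊤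
  · let _ : CommGroup G :=
      { ‹Group G› with
        mul_comm := fun a b => Subgroup.mem_center_iff.1 (by rw [hc]; trivial : b ∈ _) a }
    exact SmallDavenport.card_le_of_comm hp hm hmin hG hS
  · exact SmallDavenport.card_le_of_noncomm hp.two_le hm hmin hc hS
end

section
/- Let G be a finite noncyclic group. Then the small Davenport constant satisfies d(G) ≤ |G|/2. -/
/-- The set of all products of possibly empty subsequences of `S`, in any order. -/
def allSubseqProds {G : Type*} [Group G] (S : Multiset G) : Set G :=
  {x | ∃ l : List G, (l : Multiset G) ≤ S ∧ l.prod = x}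

section

variable {G : Type*} [Group G]

theorem one_mem_allSubseqProds (S : Multiset G) : (1 : G) ∈ allSubseqProds S :=
  ⟨[], by simp, by simp⟩

theorem allSubseqProds_mono {S T : Multiset G} (h : T ≤ S) :
    allSubseqProds T ⊆ allSubseqProds S := by
  rintro x ⟨l, hl, rfl⟩
  exact ⟨l, hl.trans h, rfl⟩

theorem mem_allSubseqProds_of_mem {S : Multiset G} {x : G} (hx : x ∈ S) :
    x ∈ allSubseqProds S :=
  ⟨[x], by simpa using hx, by simp⟩

theorem mul_left_mem_allSubseqProds_cons {T : Multiset G} {x : G} (g : G)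
    (hx : x ∈ allSubseqProds T) : g * x ∈ allSubseqProds (g ::ₘ T) := by
  obtain ⟨l, hl, rfl⟩ := hx
  exact ⟨g :: l, by rw [← Multiset.cons_coe]; exact Multiset.cons_le_cons g hl, by simp⟩

theorem mul_right_mem_allSubseqProds_cons {T : Multiset G} {x : G} (g : G)
    (hx : x ∈ allSubseqProds T) : x * g ∈ allSubseqProds (g ::ₘ T) := by
  obtain ⟨l, hl, rfl⟩ := hx
  refine ⟨l ++ [g], ?_, by simp⟩
  rw [← Multiset.coe_add, Multiset.coe_singleton, add_comm, Multiset.singleton_add]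
  exact Multiset.cons_le_cons g hl

theorem allSubseqProds_subset_subgroup {S : Multiset G} {H : Subgroup G}
    (h : ∀ x ∈ S, x ∈ H) : allSubseqProds S ⊆ H := by
  rintro x ⟨l, hl, rfl⟩
  exact H.list_prod_mem fun y hy => h y (Multiset.mem_of_le hl (by simpa using hy))

theorem OneProdFree.mono_s13 {S T : Multiset G} (hS : OneProdFree S) (h : T ≤ S) :
    OneProdFree T := by
  rintro ⟨l, hne, hl, hp⟩
  exact hS ⟨l, hne, hl.trans h, hp⟩

theorem OneProdFree.inv_notMem {g : G} {T : Multiset G} (h : OneProdFree (g ::ₘ T)) :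
    g⁻¹ ∉ allSubseqProds T := by
  rintro ⟨l, hl, hp⟩
  refine h ⟨g :: l, by simp, ?_, by simp [hp]⟩
  rw [← Multiset.cons_coe]
  exact Multiset.cons_le_cons g hl

/-- The sequence `S` is contained in a cyclic subgroup. -/
def InCyclic (S : Multiset G) : Prop :=
  ∃ c : G, ∀ x ∈ S, x ∈ Subgroup.zpowers c

theorem InCyclic.isCyclic_closure {S : Multiset G} (h : InCyclic S) :
    IsCyclic (Subgroup.closure {x | x ∈ S}) := by
  obtain ⟨c, hc⟩ := h
  have hle : Subgroup.closure {x | x ∈ S} ≤ Subgroup.zpowers c :=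
    (Subgroup.closure_le _).2 hc
  exact Subgroup.isCyclic_of_le hle

theorem inCyclic_of_isCyclic {S : Multiset G} {H : Subgroup G} (hH : IsCyclic H)
    (h : ∀ x ∈ S, x ∈ H) : InCyclic S := by
  obtain ⟨c, hc⟩ := hH.exists_generator
  refine ⟨c, fun x hx => ?_⟩
  obtain ⟨k, hk⟩ := Subgroup.mem_zpowers_iff.1 (hc ⟨x, h x hx⟩)
  exact Subgroup.mem_zpowers_iff.2 ⟨k, by simpa using congrArg Subtype.val hk⟩

theorem mul_pow_mem_of_forall_mul_mem {A : Set G} {g x : G} (h : ∀ y ∈ A, y * g ∈ A)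
    (hx : x ∈ A) (k : ℕ) : x * g ^ k ∈ A := by
  induction k with
  | zero => simpa using hx
  | succ k ih => simpa [pow_succ, mul_assoc] using h _ ih

theorem pow_mul_mem_of_forall_mul_mem {A : Set G} {g x : G} (h : ∀ y ∈ A, g * y ∈ A)
    (hx : x ∈ A) (k : ℕ) : g ^ k * x ∈ A := by
  induction k with
  | zero => simpa using hx
  | succ k ih => simpa [pow_succ', mul_assoc] using h _ ih

/-- Pairwise commuting case: if a one-product free `g ::ₘ T` has commuting terms and adjoining `g`
to `T` produces only the new product `g⁻¹`, then the product of all terms is `g⁻¹`. -/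
theorem OneProdFree.prod_eq_inv {g : G} {T : Multiset G} {l : List G}
    (h : OneProdFree (g ::ₘ T)) (hl : (l : Multiset G) = g ::ₘ T)
    (hcomm : ∀ x ∈ l, ∀ y ∈ l, Commute x y)
    (hA : allSubseqProds (g ::ₘ T) = insert g⁻¹ (allSubseqProds T)) : l.prod = g⁻¹ := by
  have hmem : l.prod ∈ allSubseqProds (g ::ₘ T) := ⟨l, hl.le, rfl⟩
  rw [hA] at hmem
  rcases hmem with hmem | ⟨t, ht, hp⟩
  · exact hmem
  obtain ⟨r, hr⟩ := Multiset.le_iff_exists_add.1 ht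
  obtain ⟨r, rfl⟩ := Quot.exists_rep r
  have hperm : l.Perm (t ++ g :: r) := by
    rw [← Multiset.coe_eq_coe, hl, hr, ← Multiset.coe_add, ← Multiset.cons_coe,
      Multiset.add_cons]
    rfl
  have hprod := hperm.prod_eq' (List.pairwise_of_forall_mem_list hcomm)
  rw [List.prod_append, hp, left_eq_mul] at hprod
  refine absurd ⟨g :: r, by simp, ?_, hprod⟩ h
  rw [← hl, Multiset.coe_eq_coe.2 hperm, ← Multiset.coe_add]
  exact Multiset.le_add_left _ _

variable [Finite G]

theorem OneProdFree.exists_pow {g : G} {T : Multiset G} (h : OneProdFree (g ::ₘ T)) :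
    ∃ q : ℕ, g ^ q ∈ allSubseqProds T ∧ g ^ (q + 1) ∉ allSubseqProds T := by
  by_contra! hcon
  have hall : ∀ q : ℕ, g ^ q ∈ allSubseqProds T := fun q => by
    induction q with
    | zero => simpa using one_mem_allSubseqProds T
    | succ q ih => exact hcon q ih
  have hinv : g⁻¹ ∈ Submonoid.powers g :=
    mem_powers_iff_mem_zpowers.2 (inv_mem (Subgroup.mem_zpowers g))
  obtain ⟨k, hk⟩ := hinv
  exact h.inv_notMem (hk ▸ hall k)

theorem OneProdFree.ncard_add_one_le {g : G} {T : Multiset G} (h : OneProdFree (g ::ₘ T)) :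
    (allSubseqProds T).ncard + 1 ≤ (allSubseqProds (g ::ₘ T)).ncard := by
  obtain ⟨q, hq, hq'⟩ := h.exists_pow
  rw [← Set.ncard_insert_of_notMem hq' (Set.toFinite _)]
  refine Set.ncard_le_ncard (Set.insert_subset ?_ ?_) (Set.toFinite _)
  · rw [pow_succ]
    exact mul_right_mem_allSubseqProds_cons g hq
  · exact allSubseqProds_mono (Multiset.le_cons_self T g)

theorem OneProdFree.card_lt_ncard {S : Multiset G} (h : OneProdFree S) :
    Multiset.card S + 1 ≤ (allSubseqProds S).ncard := by
  induction S using Multiset.induction_on with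
  | empty =>
    have := (Set.ncard_pos (Set.toFinite _)).2 ⟨1, one_mem_allSubseqProds (0 : Multiset G)⟩
    simpa [Nat.one_le_iff_ne_zero, Nat.pos_iff_ne_zero] using this
  | cons g T ih =>
    have := ih (h.mono_s13 (Multiset.le_cons_self T g))
    have := h.ncard_add_one_le
    rw [Multiset.card_cons]
    omega

/-- If all but one term lies in a cyclic subgroup not containing that term, there are at least
`2 * |S|` products. -/
theorem OneProdFree.two_mul_card_le_of_cons {g : G} {T : Multiset G}
    (h : OneProdFree (g ::ₘ T)) {H : Subgroup G} (hT : ∀ x ∈ T, x ∈ H) (hg : g ∉ H) :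
    2 * Multiset.card (g ::ₘ T) ≤ (allSubseqProds (g ::ₘ T)).ncard := by
  have hle := Multiset.le_cons_self T g
  have hcard := (h.mono_s13 hle).card_lt_ncard
  have hsub := allSubseqProds_subset_subgroup hT
  have hdisj : Disjoint (allSubseqProds T) ((g * ·) '' allSubseqProds T) := by
    rw [Set.disjoint_left]
    rintro _ hx ⟨y, hy, rfl⟩
    exact hg ((H.mul_mem_cancel_right (hsub hy)).1 (hsub hx))
  have hun : allSubseqProds T ∪ (g * ·) '' allSubseqProds T ⊆ allSubseqProds (g ::ₘ T) := by
    refine Set.union_subset (allSubseqProds_mono hle) ?_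
    rintro _ ⟨y, hy, rfl⟩
    exact mul_left_mem_allSubseqProds_cons g hy
  have hc := Set.ncard_le_ncard hun (Set.toFinite _)
  rw [Set.ncard_union_eq hdisj (Set.toFinite _) (Set.toFinite _),
    Set.ncard_image_of_injective _ (mul_right_injective g)] at hc
  rw [Multiset.card_cons]
  omega

theorem mul_inv_mem_of_forall_mul_mem {A : Set G} {g x : G} (h : ∀ y ∈ A, y * g ∈ A)
    (hx : x ∈ A) : x * g⁻¹ ∈ A := by
  obtain ⟨k, hk⟩ : g⁻¹ ∈ Submonoid.powers g :=
    mem_powers_iff_mem_zpowers.2 (inv_mem (Subgroup.mem_zpowers g))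
  rw [← hk]
  exact mul_pow_mem_of_forall_mul_mem h hx k

theorem inv_mul_mem_of_forall_mul_mem {A : Set G} {g x : G} (h : ∀ y ∈ A, g * y ∈ A)
    (hx : x ∈ A) : g⁻¹ * x ∈ A := by
  obtain ⟨k, hk⟩ : g⁻¹ ∈ Submonoid.powers g :=
    mem_powers_iff_mem_zpowers.2 (inv_mem (Subgroup.mem_zpowers g))
  rw [← hk]
  exact pow_mul_mem_of_forall_mul_mem h hx k

/-- If adjoining `g` produces just one new product, that product is a power of `g`. -/
theorem OneProdFree.exists_eq_insert_of_ncard_le {g : G} {T : Multiset G} (h : OneProdFree (g ::ₘ T))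
    (hc : (allSubseqProds (g ::ₘ T)).ncard ≤ (allSubseqProds T).ncard + 1) :
    ∃ z ∈ Subgroup.zpowers g, allSubseqProds (g ::ₘ T) = insert z (allSubseqProds T) := by
  obtain ⟨q, hq, hq'⟩ := h.exists_pow
  refine ⟨g ^ (q + 1), Subgroup.npow_mem_zpowers g _, (Set.eq_of_subset_of_ncard_le ?_ ?_
    (Set.toFinite _)).symm⟩
  · refine Set.insert_subset ?_ (allSubseqProds_mono (Multiset.le_cons_self T g))
    rw [pow_succ]
    exact mul_right_mem_allSubseqProds_cons g hq
  · rwa [Set.ncard_insert_of_notMem hq' (Set.toFinite _)]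

/-- If adjoining `g` produces just one new product, the products outside `⟨g⟩` are stable under
multiplication by `g⁻¹` on either side. -/
theorem OneProdFree.inv_mul_mem_and_mul_inv_mem {g x : G} {T : Multiset G}
    (h : OneProdFree (g ::ₘ T))
    (hc : (allSubseqProds (g ::ₘ T)).ncard ≤ (allSubseqProds T).ncard + 1)
    (hx : x ∈ allSubseqProds (g ::ₘ T)) (hxg : x ∉ Subgroup.zpowers g) :
    g⁻¹ * x ∈ allSubseqProds (g ::ₘ T) ∧ x * g⁻¹ ∈ allSubseqProds (g ::ₘ T) := by
  obtain ⟨z, hz, hA⟩ := h.exists_eq_insert_of_ncard_le hc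
  have hgg := Subgroup.mem_zpowers g
  have hT : ∀ y ∈ allSubseqProds (g ::ₘ T) \ Subgroup.zpowers g, y ∈ allSubseqProds T := by
    rintro y ⟨hy, hyg⟩
    rw [hA] at hy
    rcases hy with rfl | hy
    · exact absurd hz hyg
    · exact hy
  have hxm : x ∈ allSubseqProds (g ::ₘ T) \ Subgroup.zpowers g := ⟨hx, hxg⟩
  constructor
  · refine (inv_mul_mem_of_forall_mul_mem
      (A := allSubseqProds (g ::ₘ T) \ Subgroup.zpowers g) (fun y hy => ?_) hxm).1
    exact ⟨mul_left_mem_allSubseqProds_cons g (hT y hy), fun hm =>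
      hy.2 (((Subgroup.zpowers g).mul_mem_cancel_left hgg).1 hm)⟩
  · refine (mul_inv_mem_of_forall_mul_mem
      (A := allSubseqProds (g ::ₘ T) \ Subgroup.zpowers g) (fun y hy => ?_) hxm).1
    exact ⟨mul_right_mem_allSubseqProds_cons g (hT y hy), fun hm =>
      hy.2 (((Subgroup.zpowers g).mul_mem_cancel_right hgg).1 hm)⟩

/-- A one-product free sequence not contained in a cyclic subgroup, all of whose proper
subsequences satisfy the bound `2 * |T| ≤ |Π(T) ∪ {1}|`, satisfies it as well. -/
theorem OneProdFree.two_mul_card_le_of_forall_lt {S : Multiset G} (hS : OneProdFree S)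
    (hcyc : ¬ InCyclic S)
    (ih : ∀ T < S, ¬ InCyclic T → 2 * Multiset.card T ≤ (allSubseqProds T).ncard) :
    2 * Multiset.card S ≤ (allSubseqProds S).ncard := by
  by_contra! hlt
  have hstep : ∀ g T, S = g ::ₘ T → ¬ InCyclic T ∧
      (allSubseqProds S).ncard ≤ (allSubseqProds T).ncard + 1 ∧
      (allSubseqProds S).ncard + 1 = 2 * Multiset.card S := by
    rintro g T rfl
    have hT : ¬ InCyclic T := by
      rintro ⟨c, hc⟩
      refine absurd (hS.two_mul_card_le_of_cons hc fun hg => hcyc ⟨c, ?_⟩) hlt.not_ge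
      simpa using And.intro hg hc
    have h1 := ih T (Multiset.lt_cons_self T g) hT
    have h2 := hS.ncard_add_one_le
    rw [Multiset.card_cons] at hlt ⊢
    exact ⟨hT, by omega, by omega⟩
  have hstable : ∀ g ∈ S, ∀ x ∈ allSubseqProds S, x ∉ Subgroup.zpowers g →
      g⁻¹ * x ∈ allSubseqProds S ∧ x * g⁻¹ ∈ allSubseqProds S := by
    intro g hg x hx hxg
    obtain ⟨T, rfl⟩ := Multiset.exists_cons_of_mem hg
    exact hS.inv_mul_mem_and_mul_inv_mem (hstep g T rfl).2.1 hx hxg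
  have hinv : ∀ g ∈ S, ∀ h ∈ S, g ∉ Subgroup.zpowers h → h ∉ Subgroup.zpowers g →
      g⁻¹ ∈ allSubseqProds S := by
    intro g hg h hh hgh hhg
    have h1 := (hstable g hg h (mem_allSubseqProds_of_mem hh) hhg).1
    have h2 : g⁻¹ * h ∉ Subgroup.zpowers h := by
      rwa [Subgroup.mul_mem_cancel_right _ (Subgroup.mem_zpowers h), inv_mem_iff]
    simpa using (hstable h hh _ h1 h2).2
  have hnewprod : ∀ g T, S = g ::ₘ T → g⁻¹ ∈ allSubseqProds S →
      allSubseqProds S = insert g⁻¹ (allSubseqProds T) := by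
    rintro g T rfl hg
    obtain ⟨z, hz, hA⟩ := hS.exists_eq_insert_of_ncard_le (hstep g T rfl).2.1
    rw [hA] at hg
    rcases hg with rfl | hg
    · exact hA
    · exact absurd hg hS.inv_notMem
  have hmulinv : ∀ g ∈ S, g⁻¹ ∈ allSubseqProds S → ∀ x ∈ allSubseqProds S,
      x * g ∈ allSubseqProds S := by
    intro g hg hg' x hx
    obtain ⟨T, rfl⟩ := Multiset.exists_cons_of_mem hg
    rw [hnewprod g T rfl hg'] at hx
    rcases hx with rfl | hx
    · simpa using one_mem_allSubseqProds _
    · exact mul_right_mem_allSubseqProds_cons g hx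
  have hne : ∃ x, x ∈ S := by
    by_contra! hcon
    exact hcyc ⟨1, fun x hx => absurd hx (hcon x)⟩
  obtain ⟨m, hm, hmax⟩ := Set.exists_max_image {x | x ∈ S} orderOf (Set.toFinite _) hne
  have hcmp : ∀ k ∈ S, k ∉ Subgroup.zpowers m → m ∉ Subgroup.zpowers k := by
    intro k hk hkm hmk
    have hle : Subgroup.zpowers m ≤ Subgroup.zpowers k := Subgroup.zpowers_le.2 hmk
    have heq := Subgroup.eq_of_le_of_card_ge hle
      (by rw [Nat.card_zpowers, Nat.card_zpowers]; exact hmax k hk)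
    exact hkm (heq ▸ Subgroup.mem_zpowers k)
  obtain ⟨h, hh, hhm⟩ : ∃ h ∈ S, h ∉ Subgroup.zpowers m := by
    by_contra! hcon
    exact hcyc ⟨m, hcon⟩
  have hmstab := hmulinv m hm (hinv m hm h hh (hcmp h hh hhm) hhm)
  have hall : ∀ k ∈ S, ∀ x ∈ allSubseqProds S, x * k ∈ allSubseqProds S := by
    intro k hk
    by_cases hkm : k ∈ Subgroup.zpowers m
    · obtain ⟨i, rfl⟩ := mem_powers_iff_mem_zpowers.2 hkm
      exact fun x hx => mul_pow_mem_of_forall_mul_mem hmstab hx i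
    · exact hmulinv k hk (hinv k hk m hm hkm (hcmp k hk hkm))
  have hinvmem : ∀ k ∈ S, k⁻¹ ∈ allSubseqProds S := fun k hk => by
    simpa using mul_inv_mem_of_forall_mul_mem (hall k hk) (one_mem_allSubseqProds S)
  set K := Subgroup.closure {x | x ∈ S} with hK
  have hSK : ∀ x ∈ S, x ∈ K := fun x hx => Subgroup.subset_closure hx
  have hAK : allSubseqProds S = K := by
    refine (allSubseqProds_subset_subgroup hSK).antisymm fun x hx => ?_
    induction hx using Subgroup.closure_induction_right with
    | one => exact one_mem_allSubseqProds S
    | mul_right x _ y hy ihx => exact hall y hy x ihx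
    | mul_inv_cancel x _ y hy ihx => exact mul_inv_mem_of_forall_mul_mem (hall y hy) ihx
  have hKcard : Nat.card K + 1 = 2 * Multiset.card S := by
    obtain ⟨T, hT⟩ := Multiset.exists_cons_of_mem hm
    have h1 := (hstep m T hT).2.2
    rwa [hAK] at h1
  have hKcyc : ¬ IsCyclic K := fun hc => hcyc (inCyclic_of_isCyclic hc hSK)
  have hcomm : ∀ x ∈ S, ∀ y ∈ S, Commute x y := by
    intro x hx y hy
    by_contra hxy
    have hxney : x ≠ y := fun he => hxy (he ▸ Commute.refl x)
    obtain ⟨T, rfl⟩ := Multiset.exists_cons_of_mem hx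
    have hyT : y ∈ T := (Multiset.mem_cons.1 hy).resolve_left hxney.symm
    obtain ⟨U, rfl⟩ := Multiset.exists_cons_of_mem hyT
    have hUle : U ≤ x ::ₘ y ::ₘ U :=
      (Multiset.le_cons_self U y).trans (Multiset.le_cons_self _ x)
    have hUlt : U < x ::ₘ y ::ₘ U :=
      (Multiset.lt_cons_self U y).trans (Multiset.lt_cons_self _ x)
    simp only [Multiset.card_cons] at hKcard
    by_cases hU : InCyclic U
    · have hH := hU.isCyclic_closure
      set H := Subgroup.closure {x | x ∈ U} with hHdef
      have hHK : H ≤ K := Subgroup.closure_mono fun z hz => Multiset.mem_of_le hUle hz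
      have hUH : (allSubseqProds U).ncard ≤ Nat.card H :=
        Set.ncard_le_ncard
          (allSubseqProds_subset_subgroup fun z hz => Subgroup.subset_closure hz)
          (Set.toFinite _)
      have hUcard := (hS.mono_s13 hUle).card_lt_ncard
      have hneHK : Nat.card H ≠ Nat.card K := fun he =>
        hKcyc (Subgroup.eq_of_le_of_card_ge hHK he.ge ▸ hH)
      obtain ⟨r, hr⟩ := Subgroup.card_dvd_of_le hHK
      have h3 : 3 ≤ r := by
        by_contra! hr3
        interval_cases r <;> omega
      have : Nat.card H * 3 ≤ Nat.card H * r := Nat.mul_le_mul_left _ h3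
      have hK3 : Nat.card K = 3 := by omega
      have : Fact (Nat.Prime 3) := ⟨Nat.prime_three⟩
      exact hKcyc (isCyclic_of_prime_card hK3)
    · have hUcard := ih U hUlt hU
      have hxU := hS.inv_notMem
      have hS' : OneProdFree (y ::ₘ x ::ₘ U) := by rwa [Multiset.cons_swap]
      have hyU := hS'.inv_notMem
      have hx1 : x⁻¹ ∉ allSubseqProds U :=
        fun hm => hxU (allSubseqProds_mono (Multiset.le_cons_self U y) hm)
      have hy1 : y⁻¹ ∉ allSubseqProds U :=
        fun hm => hyU (allSubseqProds_mono (Multiset.le_cons_self U x) hm)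
      have hxy1 : (x * y)⁻¹ ∉ allSubseqProds U := fun hm => hxU (by
        simpa using mul_left_mem_allSubseqProds_cons y hm)
      have hyx1 : (y * x)⁻¹ ∉ allSubseqProds U := fun hm => hyU (by
        simpa using mul_left_mem_allSubseqProds_cons x hm)
      have hx2 : x ≠ 1 := by rintro rfl; exact hxy (Commute.one_left y)
      have hy2 : y ≠ 1 := by rintro rfl; exact hxy (Commute.one_right x)
      have hxy2 : x * y ≠ y * x := hxy
      have hsub : insert x⁻¹ (insert y⁻¹ (insert (x * y)⁻¹
          (insert (y * x)⁻¹ (allSubseqProds U)))) ⊆ (K : Set G) := by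
        have hxK := hSK x hx
        have hyK := hSK y hy
        refine Set.insert_subset (inv_mem hxK) (Set.insert_subset (inv_mem hyK)
          (Set.insert_subset (inv_mem (mul_mem hxK hyK)) (Set.insert_subset
          (inv_mem (mul_mem hyK hxK)) ?_)))
        rw [← hAK]
        exact allSubseqProds_mono hUle
      have hc := Set.ncard_le_ncard hsub (Set.toFinite _)
      rw [Set.ncard_insert_of_notMem _ (Set.toFinite _),
        Set.ncard_insert_of_notMem _ (Set.toFinite _),
        Set.ncard_insert_of_notMem _ (Set.toFinite _),
        Set.ncard_insert_of_notMem hyx1 (Set.toFinite _)] at hc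
      · have : (K : Set G).ncard = Nat.card K := rfl
        omega
      · simp only [Set.mem_insert_iff, inv_inj, not_or]
        exact ⟨hxy2, hxy1⟩
      · simp only [Set.mem_insert_iff, inv_inj, right_eq_mul, left_eq_mul, not_or]
        exact ⟨hx2, hx2, hy1⟩
      · simp only [Set.mem_insert_iff, inv_inj, right_eq_mul, left_eq_mul, not_or]
        exact ⟨hxney, hy2, hy2, hx1⟩
  obtain ⟨l, hl⟩ := Quot.exists_rep S
  have hl' : (l : Multiset G) = S := hl
  have hprod : ∀ g ∈ S, l.prod = g⁻¹ := by
    intro g hg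
    obtain ⟨T, hT⟩ := Multiset.exists_cons_of_mem hg
    have hA := hnewprod g T hT (hinvmem g hg)
    rw [← hl'] at hcomm
    rw [hT] at hA hS hl'
    exact hS.prod_eq_inv hl' (by simpa using hcomm) hA
  have heq : h = m := inv_injective ((hprod h hh).symm.trans (hprod m hm))
  exact hhm (heq ▸ Subgroup.mem_zpowers m)

/-- A one-product free sequence `S` not contained in a cyclic subgroup has at least `2 * |S|`
products, counting the empty one. -/
theorem OneProdFree.two_mul_card_le {S : Multiset G} (hS : OneProdFree S)
    (hcyc : ¬ InCyclic S) : 2 * Multiset.card S ≤ (allSubseqProds S).ncard := by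
  induction S using Multiset.strongInductionOn with
  | ih S ih =>
    exact hS.two_mul_card_le_of_forall_lt hcyc fun T hT => ih T hT (hS.mono_s13 hT.le)

theorem OneProdFree.two_mul_card_le_card {S : Multiset G} (hS : OneProdFree S)
    (hG : ¬ IsCyclic G) : 2 * Multiset.card S ≤ Nat.card G := by
  by_cases hcyc : InCyclic S
  · obtain ⟨c, hc⟩ := hcyc
    have h1 := hS.card_lt_ncard
    have h2 : (allSubseqProds S).ncard ≤ Nat.card (Subgroup.zpowers c) :=
      Set.ncard_le_ncard (allSubseqProds_subset_subgroup hc) (Set.toFinite _)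
    have h3 := (Subgroup.zpowers c).card_mul_index
    have h4 : (Subgroup.zpowers c).index ≠ 1 := fun he =>
      hG ⟨c, fun x => show x ∈ Subgroup.zpowers c by
        rw [Subgroup.index_eq_one.1 he]; trivial⟩
    have h5 : (Subgroup.zpowers c).index ≠ 0 := Subgroup.index_ne_zero_of_finite
    have h6 := Nat.mul_le_mul_left (Nat.card (Subgroup.zpowers c))
      (show 2 ≤ (Subgroup.zpowers c).index by omega)
    omega
  · refine (hS.two_mul_card_le hcyc).trans ?_
    rw [← Set.ncard_univ]
    exact Set.ncard_le_ncard (Set.subset_univ _) (Set.toFinite _)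

end

/-- Let `G` be a finite noncyclic group. Then `d(G) ≤ |G| / 2`. -/
theorem smallDavenport_le_half_card {G : Type*} [Group G] [Fintype G]
    (hG : ¬ IsCyclic G) :
    2 * smallDavenport G ≤ Fintype.card G := by
  have hle : smallDavenport G ≤ Fintype.card G / 2 := by
    refine csSup_le' ?_
    rintro n ⟨S, hS, rfl⟩
    have := hS.two_mul_card_le_card hG
    rw [Nat.card_eq_fintype_card] at this
    omega
  omega
end
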